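/- arXiv:1508.03052 — 2 statements merged into one kernel-verified Lean document; each statement's English description precedes it below -/
import Mathlib

section
/- Let T = Cat(d₁, d₂, …, d_ℓ) be a caterpillar tree with σ = σ(T) ≥ 5 and σ ≥ Δ(T) + 2, and suppose ℓ ≥ ℓ_σ, where ℓ_σ = 8 if σ = 5, ℓ_σ = 7 if σ ∈ {6,7}, and ℓ_σ = σ if σ ≥ 8. Then T is κ-two-sided strong edge-pre-colorable for every integer κ ≥ σ. -/
open SimpleGraph

/-- The degree of a vertex (cardinality of its neighbor set). -/
noncomputable def ndeg {V : Type*} (G : SimpleGraph V) (v : V) : ℕ :=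
  (G.neighborSet v).ncard

/-- `σ(G)`: the maximum of `deg x + deg y - 1` over all edges `xy` of `G`. -/
noncomputable def sigmaG {V : Type*} (G : SimpleGraph V) : ℕ :=
  sSup {m | ∃ x y, G.Adj x y ∧ m = ndeg G x + ndeg G y - 1}

/-- The maximum degree `Δ(G)`. -/
noncomputable def maxDeg {V : Type*} (G : SimpleGraph V) : ℕ :=
  sSup (Set.range (ndeg G))

/-- Two edges are at distance at most two: they share an endpoint, or an endpoint of
one is adjacent to an endpoint of the other. -/
def EdgesNear {V : Type*} (G : SimpleGraph V) (e f : Sym2 V) : Prop :=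
  ∃ u v, u ∈ e ∧ v ∈ f ∧ (u = v ∨ G.Adj u v)

/-- A strong edge-coloring: every two distinct edges at distance at most two
receive different colors. -/
def IsStrongEdgeColoring {V α : Type*} (G : SimpleGraph V) (φ : Sym2 V → α) : Prop :=
  ∀ e ∈ G.edgeSet, ∀ f ∈ G.edgeSet, e ≠ f → EdgesNear G e f → φ e ≠ φ f

/-- The strong chromatic index `χ'ₛ(G)`: the least `k` such that `G` has a strong
edge-coloring with colors `0, …, k-1`. -/
noncomputable def strongChromaticIndex {V : Type*} (G : SimpleGraph V) : ℕ :=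
  sInf {k | ∃ φ : Sym2 V → ℕ, (∀ e ∈ G.edgeSet, φ e < k) ∧ IsStrongEdgeColoring G φ}

/-- The set of edges incident with a vertex `v`. -/
def Einc {V : Type*} (G : SimpleGraph V) (v : V) : Set (Sym2 V) :=
  {e ∈ G.edgeSet | v ∈ e}
/-- The vertex type of the caterpillar tree `Cat(d 1, …, d ℓ)`: the spine
`x_0, x_1, …, x_{ℓ+1}` (as `Fin (ℓ+2)`) together with `d (i+1) - 2` pendant leaves
attached to the spine vertex `x_{i+1}` for each `i : Fin ℓ`. -/
abbrev CatV (ℓ : ℕ) (d : ℕ → ℕ) : Type :=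
  Fin (ℓ + 2) ⊕ (Σ i : Fin ℓ, Fin (d (i.val + 1) - 2))

/-- Generating relation for the caterpillar: consecutive spine vertices are adjacent,
and each leaf in the `i`-th leaf group is adjacent to the spine vertex `x_{i+1}`. -/
def CatRel (ℓ : ℕ) (d : ℕ → ℕ) : CatV ℓ d → CatV ℓ d → Prop
  | Sum.inl i, Sum.inl j => (j : ℕ) = (i : ℕ) + 1
  | Sum.inr p, Sum.inl k => (k : ℕ) = (p.1 : ℕ) + 1
  | _, _ => False

/-- The caterpillar tree `Cat(d 1, …, d ℓ)` with spine `x_0, …, x_{ℓ+1}`, in which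
the spine vertex `x_i` has degree `d i` for `1 ≤ i ≤ ℓ` (provided `d i ≥ 2`). -/
def Cat (ℓ : ℕ) (d : ℕ → ℕ) : SimpleGraph (CatV ℓ d) :=
  SimpleGraph.fromRel (CatRel ℓ d)

/-- There exists a strong edge-coloring `φ` of `Cat ℓ d` using colors from `C` with
`φ(E 1) = C₁`, `φ(E ℓ) = Cl`, `φ(x₀x₁) = α₀` and `φ(x_ℓ x_{ℓ+1}) = αl`. -/
def CatPrecolorExists (ℓ : ℕ) (d : ℕ → ℕ) (C C₁ Cl : Finset ℕ) (α₀ αl : ℕ) : Prop :=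
  ∃ φ : Sym2 (CatV ℓ d) → ℕ,
    (∀ e ∈ (Cat ℓ d).edgeSet, φ e ∈ C) ∧
    IsStrongEdgeColoring (Cat ℓ d) φ ∧
    φ '' Einc (Cat ℓ d) (Sum.inl ⟨1, by omega⟩) = ↑C₁ ∧
    φ '' Einc (Cat ℓ d) (Sum.inl ⟨ℓ, by omega⟩) = ↑Cl ∧
    φ s(Sum.inl ⟨0, by omega⟩, Sum.inl ⟨1, by omega⟩) = α₀ ∧
    φ s(Sum.inl ⟨ℓ, by omega⟩, Sum.inl ⟨ℓ + 1, by omega⟩) = αl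

/-- `Cat ℓ d` is `κ`-two-sided strong edge-pre-colorable: for every `κ`-set `C` of colors,
all `C₁, Cl ⊆ C` with `|C₁| = d 1`, `|Cl| = d ℓ`, and all `α₀ ∈ C₁`, `αl ∈ Cl`, there is
a strong edge-coloring `φ` of `Cat ℓ d` with colors from `C` such that `φ(E 1) = C₁`,
`φ(E ℓ) = Cl`, `φ(x₀x₁) = α₀` and `φ(x_ℓ x_{ℓ+1}) = αl`. -/
def TwoSidedPrecolorable (ℓ : ℕ) (d : ℕ → ℕ) (κ : ℕ) : Prop :=
  ∀ C C₁ Cl : Finset ℕ, C.card = κ → C₁ ⊆ C → Cl ⊆ C →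
    C₁.card = d 1 → Cl.card = d ℓ →
    ∀ α₀ ∈ C₁, ∀ αl ∈ Cl, CatPrecolorExists ℓ d C C₁ Cl α₀ αl

/-- `ℓ_σ` from the refined key lemma: `ℓ_5 = 8`, `ℓ_6 = ℓ_7 = 7`, `ℓ_σ = σ` for `σ ≥ 8`. -/
def ellSigma (s : ℕ) : ℕ :=
  if s = 5 then 8 else if s ≤ 7 then 7 else s

def Ex (C : Finset ℕ) (n : ℕ) (d : ℕ → ℕ) (S0 : Finset ℕ) (a : ℕ) (T : Finset ℕ) (β : ℕ) : Prop :=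
  ∃ (S : ℕ → Finset ℕ) (b : ℕ → ℕ), S 0 = S0 ∧ S n = T ∧ b 0 = a ∧ b (n + 1) = β ∧
    (∀ i ≤ n, S i ⊆ C ∧ (S i).card = d i) ∧
    (∀ i < n, S i ∩ S (i + 1) = {b (i + 1)}) ∧
    (∀ i ≤ n, b i ≠ b (i + 1))

def Col (k n : ℕ) (d : ℕ → ℕ) : Prop :=
  ∀ C S0 T : Finset ℕ, C.card = k → S0 ⊆ C → T ⊆ C → S0.card = d 0 → T.card = d n →
    ∀ a ∈ S0, ∀ β ∈ T, Ex C n d S0 a T β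

def Adm (k n : ℕ) (d : ℕ → ℕ) : Prop :=
  (∀ i ≤ n, 2 ≤ d i ∧ d i + 2 ≤ k) ∧ ∀ i < n, d i + d (i + 1) ≤ k + 1

/-- Prepending one vertex to a chain. -/
lemma Ex_cons {C : Finset ℕ} {n : ℕ} {d : ℕ → ℕ} {S0 S1 : Finset ℕ} {a b : ℕ} {T : Finset ℕ}
    {β : ℕ} (h : Ex C n (fun i => d (i + 1)) S1 b T β) (hS : S0 ⊆ C) (hc : S0.card = d 0)
    (hi : S0 ∩ S1 = {b}) (hab : a ≠ b) : Ex C (n + 1) d S0 a T β := by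
  obtain ⟨S, c, h1, h2, h3, h4, h5, h6, h7⟩ := h
  refine ⟨fun i => Nat.casesOn i S0 S, fun i => Nat.casesOn i a c, rfl, h2, rfl, h4, ?_, ?_, ?_⟩
  · rintro (_ | i) hi'
    · exact ⟨hS, hc⟩
    · exact h5 i (by omega)
  · rintro (_ | i) hi'
    · simp only [h1, h3]; exact hi
    · exact h6 i (by omega)
  · rintro (_ | i) hi'
    · simp only [h3]; exact hab
    · exact h7 i (by omega)

lemma Ex_zero {C : Finset ℕ} {d : ℕ → ℕ} {T : Finset ℕ} {b β : ℕ} (hT : T ⊆ C)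
    (hc : T.card = d 0) (hb : b ≠ β) : Ex C 0 d T b T β := by
  refine ⟨fun _ => T, fun i => if i = 0 then b else β, rfl, rfl, rfl, rfl, ?_, ?_, ?_⟩
  · intro i hi
    obtain rfl : i = 0 := by omega
    exact ⟨hT, hc⟩
  · intro i hi; omega
  · intro i hi
    obtain rfl : i = 0 := by omega
    simpa using hb

/-- One arbitrary first step. -/
lemma Col_succ {k n : ℕ} {d : ℕ → ℕ} (hA : Adm k (n + 1) d)
    (h : Col k n (fun i => d (i + 1))) : Col k (n + 1) d := by
  intro C S0 T hC hS hT hcS hcT a ha β hβ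
  have h0 := hA.1 0 (by omega)
  have h1 := hA.1 1 (by omega)
  have h01 := hA.2 0 (by omega)
  have : (S0.erase a).Nonempty := by
    rw [← Finset.card_pos, Finset.card_erase_of_mem ha]; omega
  obtain ⟨b, hb⟩ := this
  rw [Finset.mem_erase] at hb
  have hcard : (C \ S0).card = k - d 0 := by
    rw [Finset.card_sdiff_of_subset hS, hC, hcS]
  obtain ⟨R, hR, hRc⟩ := Finset.exists_subset_card_eq (s := C \ S0) (n := d 1 - 1) (by
    rw [hcard]; simp only [Nat.zero_add] at h01; omega)
  have hbR : b ∉ R := fun hh => (Finset.mem_sdiff.1 (hR hh)).2 hb.2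
  have hS1 : insert b R ⊆ C := by
    intro x hx
    rcases Finset.mem_insert.1 hx with rfl | hx
    · exact hS hb.2
    · exact (Finset.mem_sdiff.1 (hR hx)).1
  refine Ex_cons (S1 := insert b R) (b := b) ?_ hS hcS ?_ hb.1.symm
  · refine h C _ T hC hS1 hT ?_ hcT b (Finset.mem_insert_self _ _) β hβ
    rw [Finset.card_insert_of_notMem hbR, hRc]
    simp only [Nat.zero_add]; omega
  · ext x
    simp only [Finset.mem_inter, Finset.mem_insert, Finset.mem_singleton]
    constructor
    · rintro ⟨hx, rfl | hx'⟩
      · rfl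
      · exact absurd hx (Finset.mem_sdiff.1 (hR hx')).2
    · rintro rfl
      exact ⟨hb.2, Or.inl rfl⟩

/-- Removing one color `u`, carried by the independent set `X` of vertices. -/
lemma reduce {k n : ℕ} {d d' : ℕ → ℕ} (hn : 1 ≤ n) (hcol : Col k n d') (X : ℕ → Bool)
    (hd : ∀ i ≤ n, d i = d' i + if X i then 1 else 0) (hX : ∀ i < n, ¬ (X i ∧ X (i + 1)))
    (hd0 : 1 ≤ d' 0) (hdn : 1 ≤ d' n)
    {C S0 T : Finset ℕ} (hC : C.card = k + 1) (hS : S0 ⊆ C) (hT : T ⊆ C)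
    (hcS : S0.card = d 0) (hcT : T.card = d n) {a β u : ℕ} (ha : a ∈ S0) (hβ : β ∈ T)
    (hu : u ∈ C) (hX0 : X 0 ↔ u ∈ S0) (hXn : X n ↔ u ∈ T) : Ex C n d S0 a T β := by
  have key : ∀ (U : Finset ℕ) (i : ℕ) (a : ℕ), i ≤ n → a ∈ U → U.card = d i → 1 ≤ d' i →
      (X i ↔ u ∈ U) → (U.erase u).card = d' i ∧ ∃ a' ∈ U.erase u, a = a' ∨ a = u := by
    intro U i a hi haU hcU hd1 hXi
    have hc : (U.erase u).card = d' i := by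
      have := hd i hi
      by_cases h : u ∈ U
      · rw [Finset.card_erase_of_mem h, hcU, this, if_pos (hXi.2 h)]; omega
      · rw [Finset.erase_eq_of_notMem h, hcU, this, if_neg (fun hh => h (hXi.1 hh))]; omega
    refine ⟨hc, ?_⟩
    by_cases h : a = u
    · obtain ⟨a', ha'⟩ := Finset.card_pos.1 (by omega : 0 < (U.erase u).card)
      exact ⟨a', ha', Or.inr h⟩
    · exact ⟨a, Finset.mem_erase.2 ⟨h, haU⟩, Or.inl rfl⟩
  obtain ⟨hc0, a', ha', haa⟩ := key S0 0 a (by omega) ha hcS hd0 hX0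
  obtain ⟨hcn, β', hβ', hββ⟩ := key T n β le_rfl hβ hcT hdn hXn
  obtain ⟨S, b, h1, h2, h3, h4, h5, h6, h7⟩ := hcol (C.erase u) (S0.erase u) (T.erase u)
    (by rw [Finset.card_erase_of_mem hu]; omega) (Finset.erase_subset_erase _ hS)
    (Finset.erase_subset_erase _ hT) hc0 hcn a' ha' β' hβ'
  have huS : ∀ i ≤ n, u ∉ S i := fun i hi hh => by simpa using (h5 i hi).1 hh
  have hbS : ∀ i < n, b (i + 1) ∈ S i := fun i hi => by
    have : b (i + 1) ∈ S i ∩ S (i + 1) := by rw [h6 i hi]; simp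
    exact (Finset.mem_inter.1 this).1
  have hbu : ∀ i, 1 ≤ i → i ≤ n → b i ≠ u := by
    intro i hi hi' hh
    obtain ⟨j, rfl⟩ : ∃ j, i = j + 1 := ⟨i - 1, by omega⟩
    exact huS j (by omega) (hh ▸ hbS j (by omega))
  refine ⟨fun i => if X i then insert u (S i) else S i,
    fun i => if i = 0 then a else if i = n + 1 then β else b i, ?_, ?_, ?_, ?_, ?_, ?_, ?_⟩
  · dsimp only
    split_ifs with h
    · rw [h1, Finset.insert_erase (hX0.1 h)]
    · rw [h1, Finset.erase_eq_of_notMem (fun hh => h (hX0.2 hh))]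
  · dsimp only
    split_ifs with h
    · rw [h2, Finset.insert_erase (hXn.1 h)]
    · rw [h2, Finset.erase_eq_of_notMem (fun hh => h (hXn.2 hh))]
  · simp
  · simp
  · intro i hi
    have hsub : S i ⊆ C := (h5 i hi).1.trans (Finset.erase_subset _ _)
    dsimp only
    rw [hd i hi]
    split_ifs with h
    · refine ⟨Finset.insert_subset hu hsub, ?_⟩
      rw [Finset.card_insert_of_notMem (huS i hi), (h5 i hi).2]
    · exact ⟨hsub, by rw [(h5 i hi).2]; rfl⟩
  · intro i hi
    have hh := hX i hi
    have e : (if i + 1 = 0 then a else if i + 1 = n + 1 then β else b (i + 1)) = b (i + 1) := by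
      rw [if_neg (by omega), if_neg (by omega)]
    dsimp only
    rw [e, ← h6 i hi]
    have u1 := huS i (by omega)
    have u2 := huS (i + 1) (by omega)
    split_ifs with g1 g2
    · exact absurd ⟨g1, g2⟩ hh
    · rw [Finset.insert_inter_of_notMem u2]
    · rw [Finset.inter_insert_of_notMem u1]
    · rfl
  · intro i hi
    have h7i := h7 i hi
    dsimp only
    rw [if_neg (by omega : ¬ (i + 1 = 0)), if_neg (by omega : ¬ (i = n + 1))]
    by_cases hi0 : i = 0
    · subst hi0
      rw [if_pos rfl, if_neg (by omega)]
      rcases haa with rfl | rfl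
      · rw [← h3]; exact h7i
      · exact (hbu 1 le_rfl hn).symm
    · rw [if_neg hi0]
      split_ifs with hin
      · obtain rfl : i = n := by omega
        rcases hββ with rfl | rfl
        · rw [← h4]; exact h7i
        · exact hbu i (by omega) le_rfl
      · exact h7i

/-- Increasing the interior degrees makes the problem harder. -/
lemma Ex_mono {C : Finset ℕ} {n : ℕ} {d d' : ℕ → ℕ} {S0 T : Finset ℕ} {a β : ℕ}
    (ha : a ∈ S0) (hβ : β ∈ T)
    (h2 : ∀ i ≤ n, 2 ≤ d i) (hdd : ∀ i ≤ n, d i ≤ d' i) (h0 : d 0 = d' 0) (hn : d n = d' n)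
    (h : Ex C n d' S0 a T β) : Ex C n d S0 a T β := by
  obtain ⟨S, b, h1, h2', h3, h4, h5, h6, h7⟩ := h
  have hb1 : ∀ i ≤ n, b i ∈ S i := by
    rintro (_ | i) hi
    · rw [h1, h3]; exact ha
    · have : b (i + 1) ∈ S i ∩ S (i + 1) := by rw [h6 i (by omega)]; simp
      exact (Finset.mem_inter.1 this).2
  have hb2 : ∀ i ≤ n, b (i + 1) ∈ S i := by
    intro i hi
    rcases Nat.lt_or_ge i n with hi' | hi'
    · have : b (i + 1) ∈ S i ∩ S (i + 1) := by rw [h6 i hi']; simp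
      exact (Finset.mem_inter.1 this).1
    · obtain rfl : i = n := by omega
      rw [h2', h4]; exact hβ
  have hex : ∀ i, ∃ R : Finset ℕ, i ≤ n → ({b i, b (i + 1)} ⊆ R ∧ R ⊆ S i ∧ R.card = d i) := by
    intro i
    by_cases hi : i ≤ n
    · obtain ⟨R, hR⟩ := Finset.exists_subsuperset_card_eq (s := {b i, b (i + 1)}) (t := S i)
        (n := d i) (by
          intro x hx
          simp only [Finset.mem_insert, Finset.mem_singleton] at hx
          rcases hx with rfl | rfl
          · exact hb1 i hi
          · exact hb2 i hi)
        (Finset.card_le_two.trans (h2 i hi)) (by rw [(h5 i hi).2]; exact hdd i hi)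
      exact ⟨R, fun _ => hR⟩
    · exact ⟨∅, fun hh => absurd hh hi⟩
  choose R hR using hex
  have hfull : ∀ i ≤ n, d i = d' i → R i = S i := fun i hi he =>
    Finset.eq_of_subset_of_card_le (hR i hi).2.1 (by rw [(hR i hi).2.2, (h5 i hi).2, he])
  refine ⟨R, b, ?_, ?_, h3, h4, ?_, ?_, h7⟩
  · rw [hfull 0 (by omega) h0, h1]
  · rw [hfull n le_rfl hn, h2']
  · intro i hi
    exact ⟨(hR i hi).2.1.trans (h5 i hi).1, (hR i hi).2.2⟩
  · intro i hi
    apply Finset.Subset.antisymm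
    · rw [← h6 i hi]
      exact Finset.inter_subset_inter (hR i (by omega)).2.1 (hR (i + 1) (by omega)).2.1
    · intro x hx
      rw [Finset.mem_singleton] at hx
      subst hx
      exact Finset.mem_inter.2 ⟨(hR i (by omega)).1 (by simp), (hR (i + 1) (by omega)).1 (by simp)⟩
/-- `X` is a valid selection on the vertices `0, …, j`. -/
def Valid (k j : ℕ) (d : ℕ → ℕ) (X : ℕ → Bool) : Prop :=
  (∀ i < j, ¬ (X i = true ∧ X (i + 1) = true)) ∧
  (∀ i < j, d i + d (i + 1) = k + 1 → X i = true ∨ X (i + 1) = true) ∧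
  (∀ i ≤ j, d i + 2 = k → X i = true) ∧ (∀ i ≤ j, X i = true → 3 ≤ d i)

def Gd (k : ℕ) (d : ℕ → ℕ) (e : Bool) (j : ℕ) (v : Bool) : Prop :=
  ∃ X, Valid k j d X ∧ X 0 = e ∧ X j = v

lemma Gd_zero {k : ℕ} {d : ℕ → ℕ} {e : Bool} (h1 : d 0 + 2 = k → e = true)
    (h2 : e = true → 3 ≤ d 0) : Gd k d e 0 e := by
  refine ⟨fun _ => e, ⟨?_, ?_, ?_, ?_⟩, rfl, rfl⟩
  · intro i hi; omega
  · intro i hi; omega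
  · intro i hi h
    obtain rfl : i = 0 := by omega
    exact h1 h
  · intro i hi h
    obtain rfl : i = 0 := by omega
    exact h2 h

lemma Gd_step {k : ℕ} {d : ℕ → ℕ} {e : Bool} {j : ℕ} {v w : Bool} (h : Gd k d e j v)
    (h1 : ¬ (v = true ∧ w = true)) (h2 : d j + d (j + 1) = k + 1 → v = true ∨ w = true)
    (h3 : d (j + 1) + 2 = k → w = true) (h4 : w = true → 3 ≤ d (j + 1)) :
    Gd k d e (j + 1) w := by
  obtain ⟨X, ⟨g1, g2, g3, g4⟩, h0, hj⟩ := h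
  have e1 : ∀ i ≤ j, Function.update X (j + 1) w i = X i := fun i hi =>
    Function.update_of_ne (by omega) _ _
  have e2 : Function.update X (j + 1) w (j + 1) = w := Function.update_self _ _ _
  refine ⟨Function.update X (j + 1) w, ⟨?_, ?_, ?_, ?_⟩, ?_, e2⟩
  · intro i hi
    rcases Nat.lt_or_ge i j with hij | hij
    · rw [e1 i (by omega), e1 (i + 1) (by omega)]; exact g1 i hij
    · obtain rfl : i = j := by omega
      rw [e1 i le_rfl, e2, hj]; exact h1
  · intro i hi
    rcases Nat.lt_or_ge i j with hij | hij
    · rw [e1 i (by omega), e1 (i + 1) (by omega)]; exact g2 i hij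
    · obtain rfl : i = j := by omega
      rw [e1 i le_rfl, e2, hj]; exact h2
  · intro i hi
    rcases Nat.lt_or_ge j i with hij | hij
    · obtain rfl : i = j + 1 := by omega
      rw [e2]; exact h3
    · rw [e1 i hij]; exact g3 i hij
  · intro i hi
    rcases Nat.lt_or_ge j i with hij | hij
    · obtain rfl : i = j + 1 := by omega
      rw [e2]; exact h4
    · rw [e1 i hij]; exact g4 i hij
  · rw [e1 0 (by omega), h0]

def FInv (k : ℕ) (d : ℕ → ℕ) (e : Bool) (j : ℕ) : Prop :=
  (4 ≤ d j → Gd k d e j true) ∧ (d j + 2 ≠ k → Gd k d e j false)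

lemma Inv_step {k n : ℕ} {d : ℕ → ℕ} (hk : 7 ≤ k) (hA : Adm k n d) {e : Bool} {j : ℕ}
    (hj : j < n) (h : FInv k d e j) : FInv k d e (j + 1) := by
  have a1 := hA.1 j (by omega)
  have a2 := hA.1 (j + 1) (by omega)
  have a3 := hA.2 j hj
  constructor
  · intro h4
    exact Gd_step (h.2 (by omega)) (by simp) (by simp) (by simp) (fun _ => by omega)
  · intro h4
    by_cases ht : d j + d (j + 1) = k + 1
    · exact Gd_step (h.1 (by omega)) (by simp) (by simp) (fun hh => absurd hh h4) (by simp)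
    · by_cases h5 : d j + 2 = k
      · exact Gd_step (h.1 (by omega)) (by simp) (by simp) (fun hh => absurd hh h4) (by simp)
      · exact Gd_step (h.2 h5) (by simp) (fun hh => absurd hh ht) (fun hh => absurd hh h4)
          (by simp)

lemma Inv_upto {k n : ℕ} {d : ℕ → ℕ} (hk : 7 ≤ k) (hA : Adm k n d) {e : Bool}
    (h : FInv k d e 0) : ∀ j ≤ n, FInv k d e j := by
  intro j
  induction j with
  | zero => exact fun _ => h
  | succ j ih => exact fun hj => Inv_step hk hA hj (ih (by omega))

def Wk (k : ℕ) (d : ℕ → ℕ) (e : Bool) (j : ℕ) : Prop :=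
  ∃ v, Gd k d e j v ∧ (v = true → 4 ≤ d j) ∧ (v = false → d j + 2 ≠ k)

lemma Wk_upto {k n : ℕ} {d : ℕ → ℕ} (hk : 7 ≤ k) (hA : Adm k n d) {e : Bool}
    (h : Wk k d e 0) : ∀ j ≤ n, Wk k d e j := by
  intro j
  induction j with
  | zero => exact fun _ => h
  | succ j ih =>
    intro hj
    have a1 := hA.1 j (by omega)
    have a2 := hA.1 (j + 1) (by omega)
    have a3 := hA.2 j (by omega)
    obtain ⟨v, hv, v1, v2⟩ := ih (by omega)
    cases v with
    | true =>
      have := v1 rfl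
      exact ⟨false, Gd_step hv (by simp) (by simp) (fun hh => by omega) (by simp), by simp,
        fun _ => by omega⟩
    | false =>
      have := v2 rfl
      by_cases ht : d j + d (j + 1) = k + 1
      · exact ⟨true, Gd_step hv (by simp) (by simp) (by simp) (fun _ => by omega),
          fun _ => by omega, by simp⟩
      · by_cases h5 : d (j + 1) + 2 = k
        · exact ⟨true, Gd_step hv (by simp) (by simp) (by simp) (fun _ => by omega),
            fun _ => by omega, by simp⟩
        · exact ⟨false, Gd_step hv (by simp) (fun hh => absurd hh ht) (fun hh => absurd hh h5)
            (by simp), by simp, fun _ => h5⟩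

/-- Either some start value leaves full freedom, or everything so far is tight. -/
lemma dichotomy {k n : ℕ} {d : ℕ → ℕ} (hk : 7 ≤ k) (hA : Adm k n d) (h4 : 4 ≤ d 0)
    (h4' : d 0 + 3 ≤ k) : ∀ j ≤ n, (∃ e, FInv k d e j) ∨
      ((∀ e, Gd k d e j (xor e (decide (j % 2 = 1)))) ∧ (j % 2 = 0 → d j = d 0) ∧
        (j % 2 = 1 → d j + d 0 = k + 1)) := by
  intro j
  induction j with
  | zero =>
    intro _
    right
    refine ⟨fun e => ?_, fun _ => rfl, by simp⟩
    have : Gd k d e 0 e := Gd_zero (fun h => by omega) (fun _ => by omega)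
    simpa using this
  | succ j ih =>
    intro hj
    have a1 := hA.1 j (by omega)
    have a2 := hA.1 (j + 1) (by omega)
    have a3 := hA.2 j (by omega)
    rcases ih (by omega) with ⟨e, he⟩ | ⟨g1, g2, g3⟩
    · exact Or.inl ⟨e, Inv_step hk hA (by omega) he⟩
    · by_cases ht : d j + d (j + 1) = k + 1
      · right
        refine ⟨fun e => ?_, fun h => ?_, fun h => ?_⟩
        · refine Gd_step (g1 e) ?_ ?_ ?_ ?_
          · rcases Nat.mod_two_eq_zero_or_one j with h | h
            · have : (j + 1) % 2 = 1 := by omega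
              cases e <;> simp [h, this]
            · have : (j + 1) % 2 = 0 := by omega
              cases e <;> simp [h, this]
          · rcases Nat.mod_two_eq_zero_or_one j with h | h
            · have : (j + 1) % 2 = 1 := by omega
              cases e <;> simp [h, this]
            · have : (j + 1) % 2 = 0 := by omega
              cases e <;> simp [h, this]
          · intro hh; omega
          · intro hh; omega
        · have := g3 (by omega); omega
        · have := g2 (by omega); omega
      · left
        refine ⟨decide (j % 2 = 1), ?_⟩
        have hg := g1 (decide (j % 2 = 1))
        simp only [Bool.xor_self] at hg
        constructor
        · intro h4
          exact Gd_step hg (by simp) (by simp) (by simp) (fun _ => by omega)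
        · intro h4
          exact Gd_step hg (by simp) (fun hh => absurd hh ht) (fun hh => absurd hh h4) (by simp)

lemma existsX {k n : ℕ} {d : ℕ → ℕ} (hk : 7 ≤ k) (hn : (k = 7 ∧ n = 6) ∨ n + 1 = k)
    (hA : Adm k n d) {C S0 T : Finset ℕ} (hC : C.card = k) (hS : S0 ⊆ C) (hT : T ⊆ C)
    (hcS : S0.card = d 0) (hcT : T.card = d n) :
    ∃ u ∈ C, ∃ X, Valid k n d X ∧ (X 0 = true ↔ u ∈ S0) ∧ (X n = true ↔ u ∈ T) := by
  suffices h : ∃ u ∈ C, Gd k d (decide (u ∈ S0)) n (decide (u ∈ T)) by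
    obtain ⟨u, hu, X, h1, h2, h3⟩ := h
    exact ⟨u, hu, X, h1, by simp [h2], by simp [h3]⟩
  have a0 := hA.1 0 (by omega)
  have an := hA.1 n le_rfl
  have hin : ∀ U : Finset ℕ, U ⊆ C → 2 ≤ U.card → U.card + 2 ≤ k →
      ∀ e : Bool, ∃ u ∈ C, decide (u ∈ U) = e := by
    intro U hU h2 hk2 e
    cases e with
    | true =>
      obtain ⟨u, hu⟩ := Finset.card_pos.1 (by omega : 0 < U.card)
      exact ⟨u, hU hu, by simpa using hu⟩
    | false =>
      obtain ⟨u, hu, hu'⟩ := Finset.exists_mem_notMem_of_card_lt_card (s := U) (t := C) (by omega)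
      exact ⟨u, hu, by simpa using hu'⟩
  -- full freedom at the end
  have free : 4 ≤ d n → d n + 3 ≤ k → (∃ e, FInv k d e n) →
      ∃ u ∈ C, Gd k d (decide (u ∈ S0)) n (decide (u ∈ T)) := by
    rintro f1 f2 ⟨e, he⟩
    obtain ⟨u, hu, hue⟩ := hin S0 hS (by omega) (by omega) e
    refine ⟨u, hu, ?_⟩
    rw [hue]
    cases decide (u ∈ T)
    · exact he.2 (by omega)
    · exact he.1 (by omega)
  by_cases e0 : 4 ≤ d 0 ∧ d 0 + 3 ≤ k
  · by_cases en : 4 ≤ d n ∧ d n + 3 ≤ k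
    · rcases dichotomy hk hA e0.1 e0.2 n le_rfl with h | ⟨g1, g2, g3⟩
      · exact free en.1 en.2 h
      · by_contra hcon
        push Not at hcon
        have hne : ∀ u ∈ C, decide (u ∈ T) = !(xor (decide (u ∈ S0)) (decide (n % 2 = 1))) := by
          intro u hu
          by_contra hh
          apply hcon u hu
          have : decide (u ∈ T) = (xor (decide (u ∈ S0)) (decide (n % 2 = 1))) := by
            revert hh
            cases decide (u ∈ T) <;> cases (xor (decide (u ∈ S0)) (decide (n % 2 = 1))) <;> simp
          rw [this]
          exact g1 _
        rcases Nat.mod_two_eq_zero_or_one n with hp | hp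
        · have : T = C \ S0 := by
            ext u
            rw [Finset.mem_sdiff]
            constructor
            · intro hu
              refine ⟨hT hu, fun hh => ?_⟩
              have := hne u (hT hu)
              simp [hp, hu, hh] at this
            · rintro ⟨hu, hu'⟩
              have := hne u hu
              simpa [hp, hu'] using this
          have hc := congrArg Finset.card this
          rw [Finset.card_sdiff_of_subset hS, hcT, hcS, hC, g2 hp] at hc
          omega
        · have : T = S0 := by
            ext u
            constructor
            · intro hu
              have := hne u (hT hu)
              simpa [hp, hu] using this
            · intro hu
              have := hne u (hS hu)
              simpa [hp, hu] using this
          have hc := congrArg Finset.card this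
          rw [hcT, hcS] at hc
          have := g3 hp
          omega
    · -- last end extreme, first free
      have hW : ∀ e, Wk k d e n := fun e => by
        refine Wk_upto hk hA ⟨e, Gd_zero (fun h => by omega) (fun _ => by omega), fun _ => e0.1,
          fun _ => by omega⟩ n le_rfl
      obtain ⟨u, hu, hue⟩ := hin T hT (by omega) (by omega) (decide (4 ≤ d n))
      refine ⟨u, hu, ?_⟩
      obtain ⟨v, hv, v1, v2⟩ := hW (decide (u ∈ S0))
      rw [hue]
      have : v = decide (4 ≤ d n) := by
        cases v with
        | true => simpa using v1 rfl
        | false =>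
          have := v2 rfl
          symm
          rw [decide_eq_false_iff_not]
          omega
      rw [← this]; exact hv
  · -- first end extreme
    have hI : FInv k d (decide (4 ≤ d 0)) 0 := by
      constructor
      · intro h
        have : Gd k d true 0 true := Gd_zero (fun _ => rfl) (fun _ => by omega)
        simpa [h] using this
      · intro h
        have h' : ¬ 4 ≤ d 0 := by omega
        have : Gd k d false 0 false := Gd_zero (fun hh => absurd hh h) (by simp)
        simpa [h'] using this
    have hIn := Inv_upto hk hA hI n le_rfl
    by_cases en : 4 ≤ d n ∧ d n + 3 ≤ k
    · exact free en.1 en.2 ⟨_, hIn⟩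
    · -- both extreme
      have hex : ∃ u ∈ C, decide (u ∈ S0) = decide (4 ≤ d 0) ∧
          decide (u ∈ T) = decide (4 ≤ d n) := by
        by_cases h0 : 4 ≤ d 0 <;> by_cases h1 : 4 ≤ d n
        · have : (S0 ∩ T).Nonempty := by
            rw [← Finset.card_pos]
            have h2 := Finset.card_union_add_card_inter S0 T
            have h3 := Finset.card_le_card (Finset.union_subset hS hT)
            omega
          obtain ⟨u, hu⟩ := this
          rw [Finset.mem_inter] at hu
          exact ⟨u, hS hu.1, by simp [hu.1, h0], by simp [hu.2, h1]⟩
        · obtain ⟨u, hu, hu'⟩ := Finset.exists_mem_notMem_of_card_lt_card (s := T) (t := S0)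
            (by omega)
          exact ⟨u, hS hu, by simp [hu, h0], by simp [hu', h1]⟩
        · obtain ⟨u, hu, hu'⟩ := Finset.exists_mem_notMem_of_card_lt_card (s := S0) (t := T)
            (by omega)
          exact ⟨u, hT hu, by simp [hu', h0], by simp [hu, h1]⟩
        · obtain ⟨u, hu, hu'⟩ := Finset.exists_mem_notMem_of_card_lt_card (s := S0 ∪ T) (t := C)
            (by have := Finset.card_union_le S0 T; omega)
          rw [Finset.mem_union] at hu'
          push Not at hu'
          exact ⟨u, hu, by simp [hu'.1, h0], by simp [hu'.2, h1]⟩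
      obtain ⟨u, hu, hu0, hun⟩ := hex
      refine ⟨u, hu, ?_⟩
      rw [hu0, hun]
      by_cases h1 : 4 ≤ d n
      · simpa [h1] using hIn.1 h1
      · simpa [h1] using hIn.2 (by omega)

/-- Induction step in the number of colors. -/
lemma Col_color_step {k n : ℕ} (hk : 6 ≤ k) (hn : (k + 1 = 7 ∧ n = 6) ∨ n + 1 = k + 1)
    (ih : ∀ d, Adm k n d → Col k n d) {d : ℕ → ℕ} (hA : Adm (k + 1) n d) : Col (k + 1) n d := by
  intro C S0 T hC hS hT hcS hcT a ha β hβ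
  obtain ⟨u, hu, X, ⟨v1, v2, v3, v4⟩, hX0, hXn⟩ :=
    existsX (by omega) hn hA hC hS hT hcS hcT
  have hd : ∀ i ≤ n, 2 ≤ d i - (if X i then 1 else 0) ∧
      d i = (d i - (if X i then 1 else 0)) + (if X i then 1 else 0) := by
    intro i hi
    have := hA.1 i hi
    have := v4 i hi
    split_ifs with h
    · have := this h; omega
    · omega
  refine reduce (d' := fun i => d i - (if X i then 1 else 0)) (by omega) (ih _ ⟨?_, ?_⟩) X
    (fun i hi => (hd i hi).2) v1 ?_ ?_ hC hS hT hcS hcT ha hβ hu hX0 hXn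
  · intro i hi
    refine ⟨(hd i hi).1, ?_⟩
    have := hA.1 i hi
    have := v3 i hi
    dsimp only
    split_ifs with h
    · omega
    · have : d i + 2 ≠ k + 1 := fun hh => h (this hh)
      omega
  · intro i hi
    have a := hA.2 i hi
    have b := v2 i hi
    have c1 := v4 i (by omega)
    have c2 := v4 (i + 1) (by omega)
    dsimp only
    split_ifs with h h' h'
    · exact absurd ⟨h, h'⟩ (v1 i hi)
    · have := c1 h; omega
    · have := c2 h'; omega
    · have : d i + d (i + 1) ≠ k + 1 + 1 := fun hh => (b hh).elim h h'
      omega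
  · have := (hd 0 (by omega)).1; omega
  · have := (hd n (by omega)).1; omega

/-- More colors than needed. -/
lemma Col_more {k n : ℕ} (hk : 5 ≤ k) (hn : 2 ≤ n) (h : ∀ d, Adm k n d → Col k n d) :
    ∀ κ, k ≤ κ → ∀ d, Adm k n d → Col κ n d := by
  intro κ hκ
  induction κ, hκ using Nat.le_induction with
  | base => exact h
  | succ κ hκ ih =>
    intro d hA C S0 T hC hS hT hcS hcT a ha β hβ
    have a0 := hA.1 0 (by omega)
    have an := hA.1 n le_rfl
    obtain ⟨u, hu, hu0, hun⟩ : ∃ u ∈ C, (u ∈ S0 → 3 ≤ d 0) ∧ (u ∈ T → 3 ≤ d n) := by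
      by_cases h0 : 3 ≤ d 0
      · by_cases h1 : 3 ≤ d n
        · obtain ⟨u, hu⟩ := Finset.card_pos.1 (by omega : 0 < C.card)
          exact ⟨u, hu, fun _ => h0, fun _ => h1⟩
        · obtain ⟨u, hu, hu'⟩ := Finset.exists_mem_notMem_of_card_lt_card (s := T) (t := C)
            (by omega)
          exact ⟨u, hu, fun _ => h0, fun hh => absurd hh hu'⟩
      · by_cases h1 : 3 ≤ d n
        · obtain ⟨u, hu, hu'⟩ := Finset.exists_mem_notMem_of_card_lt_card (s := S0) (t := C)
            (by omega)
          exact ⟨u, hu, fun hh => absurd hh hu', fun _ => h1⟩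
        · obtain ⟨u, hu, hu'⟩ := Finset.exists_mem_notMem_of_card_lt_card (s := S0 ∪ T) (t := C)
            (by have := Finset.card_union_le S0 T; omega)
          rw [Finset.mem_union] at hu'
          push Not at hu'
          exact ⟨u, hu, fun hh => absurd hh hu'.1, fun hh => absurd hh hu'.2⟩
    let X : ℕ → Bool := fun i => (decide (i = 0) && decide (u ∈ S0)) ||
      (decide (i = n) && decide (u ∈ T))
    have hX0 : X 0 = true ↔ u ∈ S0 := by
      have : (0 : ℕ) ≠ n := by omega
      simp [X, this]
    have hXn : X n = true ↔ u ∈ T := by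
      have : n ≠ 0 := by omega
      simp [X, this]
    have hX3 : ∀ i, X i = true → 3 ≤ d i := by
      intro i hi
      simp only [X, Bool.or_eq_true, Bool.and_eq_true, decide_eq_true_eq] at hi
      rcases hi with ⟨rfl, hh⟩ | ⟨rfl, hh⟩
      · exact hu0 hh
      · exact hun hh
    have hX1 : ∀ i < n, ¬ (X i = true ∧ X (i + 1) = true) := by
      rintro i hi ⟨h1, h2⟩
      simp only [X, Bool.or_eq_true, Bool.and_eq_true, decide_eq_true_eq] at h1 h2
      omega
    have hd : ∀ i ≤ n, 2 ≤ d i - (if X i then 1 else 0) ∧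
        d i = (d i - (if X i then 1 else 0)) + (if X i then 1 else 0) := by
      intro i hi
      have := hA.1 i hi
      have := hX3 i
      split_ifs with h
      · have := this h; omega
      · omega
    refine reduce (d' := fun i => d i - (if X i then 1 else 0)) (by omega) (ih _ ⟨?_, ?_⟩) X
      (fun i hi => (hd i hi).2) hX1 ?_ ?_ hC hS hT hcS hcT ha hβ hu hX0 hXn
    · intro i hi
      refine ⟨(hd i hi).1, ?_⟩
      have := hA.1 i hi
      dsimp only
      omega
    · intro i hi
      have := hA.2 i hi
      dsimp only
      omega
    · have := (hd 0 (by omega)).1; omega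
    · have := (hd n (by omega)).1; omega
/-- The bit masks of the `d`-subsets of `{0, …, k-1}`, tabulated for the cases used below. -/
def masks (k d : ℕ) : List ℕ :=
  match k, d with
  | 5, 2 => [3, 5, 6, 9, 10, 12, 17, 18, 20, 24]
  | 5, 3 => [7, 11, 13, 14, 19, 21, 22, 25, 26, 28]
  | 6, 2 => [3, 5, 6, 9, 10, 12, 17, 18, 20, 24, 33, 34, 36, 40, 48]
  | 6, 3 => [7, 11, 13, 14, 19, 21, 22, 25, 26, 28, 35, 37, 38, 41, 42, 44, 49, 50, 52, 56]
  | 6, 4 => [15, 23, 27, 29, 30, 39, 43, 45, 46, 51, 53, 54, 57, 58, 60]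
  | _, _ => []

/-- In the layer `L`, the row of `m` contains a color other than `b`. -/
def win (L m b : ℕ) : Bool :=
  ! Nat.beq (((L >>> (8 * m)) % 256) ||| 2 ^ b) (2 ^ b)

def okb (k dn L m b : ℕ) : Bool :=
  m.testBit b && (masks k dn).any fun m' => Nat.beq (m &&& m') (2 ^ b) && win L m' b

def addRow (k dn L m : ℕ) (acc : ℕ) : ℕ :=
  (List.range k).foldr
    (fun b acc => bif okb k dn L m b then acc ||| 2 ^ (8 * m + b) else acc) acc

def stepL (k d dn L : ℕ) : ℕ :=
  (masks k d).foldr (fun m acc => addRow k dn L m acc) 0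

def chk (k : ℕ) (ends ints : List ℕ) : ℕ → ℕ → ℕ → Bool
  | 0, dn, L => ends.all fun d => Nat.blt (k + 1) (d + dn) ||
      (masks k d).all fun m => (List.range k).all fun a => ! m.testBit a || win (stepL k d dn L) m a
  | n + 1, dn, L => ints.all fun d => Nat.blt (k + 1) (d + dn) ||
      chk k ends ints n d (stepL k d dn L)

def chkAll (k : ℕ) (ends ints : List ℕ) (n : ℕ) : Bool :=
  ends.all fun t => chk k ends ints n t (2 ^ (8 * (2 ^ t - 1)))

set_option maxRecDepth 100000 in
lemma chk5 : chkAll 5 [2, 3] [3] 6 = true := by decide +kernel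

set_option maxRecDepth 100000 in
lemma chk6 : chkAll 6 [2, 3, 4] [3, 4] 5 = true := by decide +kernel

def popc (k m : ℕ) : ℕ := ((List.range k).filter fun i => m.testBit i).length

def MasksOK (k d : ℕ) : Prop :=
  (∀ m ∈ masks k d, popc k m = d) ∧ ∀ m < 2 ^ k, popc k m = d → m ∈ masks k d

lemma masksOK5 : ∀ d ∈ [2, 3], MasksOK 5 d := by
  simp only [List.mem_cons, List.not_mem_nil, or_false, forall_eq_or_imp, forall_eq]
  refine ⟨⟨?_, ?_⟩, ⟨?_, ?_⟩⟩ <;> decide +kernel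

lemma masksOK6 : ∀ d ∈ [2, 3, 4], MasksOK 6 d := by
  simp only [List.mem_cons, List.not_mem_nil, or_false, forall_eq_or_imp, forall_eq]
  refine ⟨⟨?_, ?_⟩, ⟨?_, ?_⟩, ⟨?_, ?_⟩⟩ <;> decide +kernel

lemma testBit_two_pow' {a i : ℕ} : (2 ^ a).testBit i = true ↔ a = i := by
  rw [Nat.testBit_two_pow]; simp

lemma win_spec {L m b : ℕ} (h : win L m b = true) :
    ∃ b' < 8, b' ≠ b ∧ L.testBit (8 * m + b') = true := by
  by_contra hcon
  push Not at hcon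
  have : ((L >>> (8 * m)) % 256) ||| 2 ^ b = 2 ^ b := by
    apply Nat.eq_of_testBit_eq
    intro i
    rw [Nat.testBit_or]
    by_cases hib : i = b
    · subst hib
      simp
    · have h1 : ((L >>> (8 * m)) % 256).testBit i = false := by
        rw [show (256 : ℕ) = 2 ^ 8 by norm_num, Nat.testBit_mod_two_pow, Nat.testBit_shiftRight]
        by_cases hi : i < 8
        · have := hcon i hi hib
          simp only [Bool.not_eq_true] at this
          simp [this]
        · simp [hi]
      simp [h1]
  unfold win at h
  rw [this] at h
  simp at h

lemma addRow_spec {k dn L m acc j : ℕ} (h : (addRow k dn L m acc).testBit j = true) :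
    acc.testBit j = true ∨ ∃ b < k, okb k dn L m b = true ∧ j = 8 * m + b := by
  unfold addRow at h
  have gen : ∀ l : List ℕ, (l.foldr (fun b acc => bif okb k dn L m b then
      acc ||| 2 ^ (8 * m + b) else acc) acc).testBit j = true →
      acc.testBit j = true ∨ ∃ b ∈ l, okb k dn L m b = true ∧ j = 8 * m + b := by
    intro l
    induction l with
    | nil => intro h; exact Or.inl h
    | cons b l ih =>
      intro h
      rw [List.foldr_cons] at h
      cases hb : okb k dn L m b with
      | false =>
        rw [hb, cond_false] at h
        rcases ih h with h | ⟨b', h1, h2⟩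
        · exact Or.inl h
        · exact Or.inr ⟨b', List.mem_cons_of_mem _ h1, h2⟩
      | true =>
        rw [hb, cond_true, Nat.testBit_or, Bool.or_eq_true] at h
        rcases h with h | h
        · rcases ih h with h | ⟨b', h1, h2⟩
          · exact Or.inl h
          · exact Or.inr ⟨b', List.mem_cons_of_mem _ h1, h2⟩
        · exact Or.inr ⟨b, List.mem_cons_self, hb, (testBit_two_pow'.1 h).symm⟩
  rcases gen _ h with h | ⟨b, h1, h2⟩
  · exact Or.inl h
  · exact Or.inr ⟨b, List.mem_range.1 h1, h2⟩

lemma stepL_spec {k d dn L j : ℕ} (h : (stepL k d dn L).testBit j = true) :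
    ∃ m ∈ masks k d, ∃ b < k, okb k dn L m b = true ∧ j = 8 * m + b := by
  unfold stepL at h
  revert h
  generalize masks k d = l
  induction l with
  | nil => intro h; simp at h
  | cons m l ih =>
    intro h
    rw [List.foldr_cons] at h
    rcases addRow_spec h with h | h
    · obtain ⟨m', h1, h2⟩ := ih h
      exact ⟨m', List.mem_cons_of_mem _ h1, h2⟩
    · exact ⟨m, List.mem_cons_self, h⟩

/-- The set of colors coded by a mask. -/
def FS (k : ℕ) (f : ℕ → ℕ) (m : ℕ) : Finset ℕ :=
  ((Finset.range k).filter fun i => m.testBit i = true).image f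

lemma mem_FS {k : ℕ} {f : ℕ → ℕ} {m x : ℕ} :
    x ∈ FS k f m ↔ ∃ i < k, m.testBit i = true ∧ f i = x := by
  simp [FS, and_assoc]

lemma card_FS {k : ℕ} {f : ℕ → ℕ} (hf : ∀ i < k, ∀ j < k, f i = f j → i = j) (m : ℕ) :
    (FS k f m).card = popc k m := by
  unfold FS
  rw [Finset.card_image_of_injOn]
  · have : popc k m = ((List.range k).filter fun i => decide (m.testBit i = true)).length := by
      simp [popc]
    rw [this]
    rfl
  · intro i hi j hj h
    have hi := Finset.mem_filter.1 (Finset.mem_coe.1 hi)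
    have hj := Finset.mem_filter.1 (Finset.mem_coe.1 hj)
    exact hf i (Finset.mem_range.1 hi.1) j (Finset.mem_range.1 hj.1) h

lemma FS_inter {k : ℕ} {f : ℕ → ℕ} (hf : ∀ i < k, ∀ j < k, f i = f j → i = j) {m m' b : ℕ}
    (hb : b < k) (h : m &&& m' = 2 ^ b) : FS k f m ∩ FS k f m' = {f b} := by
  have hbit : ∀ i, (m.testBit i = true ∧ m'.testBit i = true) ↔ b = i := by
    intro i
    rw [← testBit_two_pow', ← h, Nat.testBit_and, Bool.and_eq_true]
  ext x
  rw [Finset.mem_inter, mem_FS, mem_FS, Finset.mem_singleton]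
  constructor
  · rintro ⟨⟨i, hi, h1, rfl⟩, ⟨j, hj, h2, h3⟩⟩
    obtain rfl := hf j hj i hi h3
    rw [(hbit j).1 ⟨h1, h2⟩]
  · rintro rfl
    have := (hbit b).2 rfl
    exact ⟨⟨b, hb, this.1, rfl⟩, ⟨b, hb, this.2, rfl⟩⟩

def LOK (k : ℕ) (f : ℕ → ℕ) (C T : Finset ℕ) (β : ℕ) (d : ℕ → ℕ) (j r L : ℕ) : Prop :=
  ∀ m, ∀ b < 8, L.testBit (8 * m + b) = true → b < k ∧
    ∀ a, a ≠ f b → Ex C r (fun i => d (j + i)) (FS k f m) a T β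

lemma LOK_step {k : ℕ} {f : ℕ → ℕ} {C T : Finset ℕ} {β : ℕ} {d : ℕ → ℕ} {j r L : ℕ} (hk : k ≤ 8)
    (hf : ∀ i < k, ∀ j < k, f i = f j → i = j) (hC : ∀ i < k, f i ∈ C)
    (hm : MasksOK k (d j)) (h : LOK k f C T β d (j + 1) r L) :
    LOK k f C T β d j (r + 1) (stepL k (d j) (d (j + 1)) L) := by
  intro m b hb hL
  obtain ⟨m0, hm0, b0, hb0, hok, he⟩ := stepL_spec hL
  obtain rfl : m0 = m := by omega
  obtain rfl : b0 = b := by omega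
  refine ⟨hb0, fun a ha => ?_⟩
  unfold okb at hok
  rw [Bool.and_eq_true, List.any_eq_true] at hok
  obtain ⟨h1, m', h2, h3⟩ := hok
  rw [Bool.and_eq_true] at h3
  obtain ⟨b', hb', hne, hL'⟩ := win_spec h3.2
  obtain ⟨hb'k, hEx⟩ := h m' b' hb' hL'
  have hE := hEx (f b0) (fun hh => hne (hf _ hb0 _ hb'k hh).symm)
  refine Ex_cons (S1 := FS k f m') (b := f b0) ?_ ?_ ?_ ?_ ha
  · have : (fun i => d (j + (i + 1))) = fun i => d (j + 1 + i) := by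
      funext i; congr 1; omega
    rw [this]; exact hE
  · intro x hx
    obtain ⟨i, hi, _, rfl⟩ := mem_FS.1 hx
    exact hC i hi
  · rw [card_FS hf, hm.1 _ hm0]; rfl
  · exact FS_inter hf hb0 (Nat.eq_of_beq_eq_true h3.1)

lemma chk_sound {k : ℕ} {f : ℕ → ℕ} {C T : Finset ℕ} {β : ℕ} {d : ℕ → ℕ} {n : ℕ}
    {ends ints : List ℕ} (hk : k ≤ 8)
    (hf : ∀ i < k, ∀ j < k, f i = f j → i = j) (hC : ∀ i < k, f i ∈ C)
    (hm : ∀ j < n, MasksOK k (d j)) (hsum : ∀ j < n, d j + d (j + 1) ≤ k + 1)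
    (h0 : d 0 ∈ ends) (hint : ∀ j, 1 ≤ j → j < n → d j ∈ ints) :
    ∀ N r L, N + 1 + r = n → chk k ends ints N (d (N + 1)) L = true →
      LOK k f C T β d (N + 1) r L → ∀ m < 2 ^ k, popc k m = d 0 → ∀ a < k, m.testBit a = true →
      Ex C n d (FS k f m) (f a) T β := by
  intro N
  induction N with
  | zero =>
    intro r L hn hchk hL m hm2 hpop a ha hma
    have hL0 := LOK_step hk hf hC (hm 0 (by omega)) hL
    unfold chk at hchk
    rw [List.all_eq_true] at hchk
    have h1 := hchk (d 0) h0
    rw [Bool.or_eq_true] at h1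
    rcases h1 with h1 | h1
    · have := hsum 0 (by omega)
      have h2 : k + 1 < d 0 + d (0 + 1) := by simpa [Nat.blt_eq] using h1
      omega
    · rw [List.all_eq_true] at h1
      have h2 := h1 m ((hm 0 (by omega)).2 m hm2 hpop)
      rw [List.all_eq_true] at h2
      have h3 := h2 a (List.mem_range.2 ha)
      rw [hma] at h3
      simp only [Bool.not_true, Bool.false_or] at h3
      obtain ⟨b, hb, hba, hLb⟩ := win_spec h3
      obtain ⟨hbk, hE⟩ := hL0 m b hb hLb
      have := hE (f a) (fun hh => hba (hf _ ha _ hbk hh).symm)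
      obtain rfl : n = r + 1 := by omega
      simpa using this
  | succ N ih =>
    intro r L hn hchk hL
    have hL0 := LOK_step hk hf hC (hm (N + 1) (by omega)) hL
    unfold chk at hchk
    rw [List.all_eq_true] at hchk
    have h1 := hchk (d (N + 1)) (hint (N + 1) (by omega) (by omega))
    rw [Bool.or_eq_true] at h1
    rcases h1 with h1 | h1
    · have := hsum (N + 1) (by omega)
      have h2 : k + 1 < d (N + 1) + d (N + 1 + 1) := by simpa [Nat.blt_eq] using h1
      omega
    · exact ih (r + 1) _ (by omega) h1 hL0

/-- Normal form for the target: enumerate `C` with `β` first and `T` as an initial segment. -/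
lemma exists_enum {C T : Finset ℕ} {β : ℕ} (hT : T ⊆ C) (hβ : β ∈ T) :
    ∃ f : ℕ → ℕ, (∀ i < C.card, ∀ j < C.card, f i = f j → i = j) ∧
      (∀ i < C.card, f i ∈ C) ∧ (∀ x ∈ C, ∃ i < C.card, f i = x) ∧
      f 0 = β ∧ ∀ i < C.card, f i ∈ T ↔ i < T.card := by
  let l : List ℕ := β :: ((T.erase β).toList ++ (C \ T).toList)
  have hTc : 0 < T.card := Finset.card_pos.2 ⟨β, hβ⟩
  have hlen : l.length = C.card := by
    simp only [l, List.length_cons, List.length_append, Finset.length_toList,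
      Finset.card_erase_of_mem hβ, Finset.card_sdiff_of_subset hT]
    have := Finset.card_le_card hT
    omega
  have hmem : ∀ x, x ∈ l ↔ x ∈ C := by
    intro x
    simp only [l, List.mem_cons, List.mem_append, Finset.mem_toList, Finset.mem_erase,
      Finset.mem_sdiff]
    constructor
    · rintro (rfl | ⟨_, h⟩ | h)
      · exact hT hβ
      · exact hT h
      · exact h.1
    · intro h
      by_cases h1 : x = β
      · exact Or.inl h1
      · by_cases h2 : x ∈ T
        · exact Or.inr (Or.inl ⟨h1, h2⟩)
        · exact Or.inr (Or.inr ⟨h, h2⟩)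
  have hnd : l.Nodup := by
    simp only [l, List.nodup_cons, List.mem_append, Finset.mem_toList, Finset.mem_erase,
      Finset.mem_sdiff, List.nodup_append, Finset.nodup_toList]
    refine ⟨by tauto, trivial, trivial, ?_⟩
    rintro a ⟨_, h⟩ b ⟨_, h'⟩ rfl
    exact h' h
  have hget : ∀ i, (hi : i < C.card) → l.getD i 0 = l[i]'(by omega) := by
    intro i hi
    rw [List.getD_eq_getElem]
  refine ⟨fun i => l.getD i 0, ?_, ?_, ?_, rfl, ?_⟩
  · intro i hi j hj h
    simp only [hget i hi, hget j hj] at h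
    exact (hnd.getElem_inj_iff).1 h
  · intro i hi
    simp only [hget i hi]
    exact (hmem _).1 (List.getElem_mem _)
  · intro x hx
    obtain ⟨i, hi, h⟩ := List.getElem_of_mem ((hmem x).2 hx)
    exact ⟨i, by omega, by simp only [hget i (by omega)]; exact h⟩
  · intro i hi
    simp only [hget i hi]
    rcases i with _ | i
    · simp [l, hβ, hTc]
    · have hc : (T.erase β).toList.length = T.card - 1 := by
        rw [Finset.length_toList, Finset.card_erase_of_mem hβ]
      simp only [l, List.getElem_cons_succ]
      by_cases h : i < T.card - 1
      · rw [List.getElem_append_left (by omega)]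
        have : (T.erase β).toList[i] ∈ (T.erase β).toList := List.getElem_mem _
        rw [Finset.mem_toList, Finset.mem_erase] at this
        constructor
        · intro _; omega
        · intro _; exact this.2
      · rw [List.getElem_append_right (by omega)]
        have hlt : i - (T.erase β).toList.length < (C \ T).toList.length := by
          have : l.length = (T.erase β).toList.length + (C \ T).toList.length + 1 := by
            simp [l]
          omega
        have : (C \ T).toList[i - (T.erase β).toList.length] ∈ (C \ T).toList := List.getElem_mem _
        rw [Finset.mem_toList, Finset.mem_sdiff] at this
        constructor
        · intro hh; exact absurd hh this.2
        · intro _; omega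

lemma base {k n : ℕ} {ends ints : List ℕ} {d : ℕ → ℕ} (hk : k ≤ 8) (hn : 1 ≤ n)
    (hchk : chkAll k ends ints (n - 1) = true)
    (hm : ∀ j ≤ n, MasksOK k (d j)) (hsum : ∀ j < n, d j + d (j + 1) ≤ k + 1)
    (h0 : d 0 ∈ ends) (hdn : d n ∈ ends) (hint : ∀ j, 1 ≤ j → j < n → d j ∈ ints) :
    Col k n d := by
  intro C S0 T hC hS hT hcS hcT a ha β hβ
  obtain ⟨f, f1, f2, f3, f4, f5⟩ := exists_enum hT hβ
  rw [hC] at f1 f2 f3 f5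
  have htk : d n ≤ k := by rw [← hcT, ← hC]; exact Finset.card_le_card hT
  have hFT : FS k f (2 ^ (d n) - 1) = T := by
    ext x
    rw [mem_FS]
    constructor
    · rintro ⟨i, hi, h1, rfl⟩
      rw [Nat.testBit_two_pow_sub_one, decide_eq_true_eq] at h1
      rw [f5 i hi, hcT]; exact h1
    · intro hx
      obtain ⟨i, hi, rfl⟩ := f3 x (hT hx)
      refine ⟨i, hi, ?_, rfl⟩
      rw [Nat.testBit_two_pow_sub_one, decide_eq_true_eq, ← hcT]
      exact (f5 i hi).1 hx
  have hL : LOK k f C T β d n 0 (2 ^ (8 * (2 ^ (d n) - 1))) := by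
    intro m b hb hbit
    have he := testBit_two_pow'.1 hbit
    obtain rfl : b = 0 := by omega
    obtain rfl : m = 2 ^ (d n) - 1 := by omega
    have hkpos : 0 < k := by rw [← hC]; exact Finset.card_pos.2 ⟨β, hT hβ⟩
    refine ⟨hkpos, fun a ha => ?_⟩
    rw [hFT]
    exact Ex_zero hT hcT (f4 ▸ ha)
  obtain ⟨p, rfl⟩ : ∃ p, n = p + 1 := ⟨n - 1, by omega⟩
  unfold chkAll at hchk
  rw [List.all_eq_true] at hchk
  have hc := hchk _ hdn
  -- mask of the initial set
  let m := Nat.ofBits (fun i : Fin k => decide (f i ∈ S0))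
  have hmb : ∀ i < k, m.testBit i = decide (f i ∈ S0) := by
    intro i hi
    exact Nat.testBit_ofBits_lt _ _ hi
  have hFm : FS k f m = S0 := by
    ext x
    rw [mem_FS]
    constructor
    · rintro ⟨i, hi, h1, rfl⟩
      rw [hmb i hi] at h1
      simpa using h1
    · intro hx
      obtain ⟨i, hi, rfl⟩ := f3 x (hS hx)
      exact ⟨i, hi, by rw [hmb i hi]; simpa using hx, rfl⟩
  obtain ⟨i, hi, rfl⟩ := f3 a (hS ha)
  have := chk_sound (T := T) (β := β) (n := p + 1) hk f1 f2 (fun j hj => hm j (by omega)) hsum h0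
    hint p 0 _ rfl (by simpa using hc) hL m (Nat.ofBits_lt_two_pow _)
    (by rw [← card_FS f1, hFm, hcS]) i hi (by rw [hmb i hi]; simpa using ha)
  rw [hFm] at this
  exact this

lemma Col_of_raise {k n : ℕ} {d d' : ℕ → ℕ} (h2 : ∀ i ≤ n, 2 ≤ d i) (hdd : ∀ i ≤ n, d i ≤ d' i)
    (h0 : d 0 = d' 0) (hn : d n = d' n) (h : Col k n d') : Col k n d := by
  intro C S0 T hC hS hT hcS hcT a ha β hβ
  exact Ex_mono ha hβ h2 hdd h0 hn
    (h C S0 T hC hS hT (by rw [hcS, h0]) (by rw [hcT, hn]) a ha β hβ)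

lemma Col5 {d : ℕ → ℕ} (hA : Adm 5 7 d) : Col 5 7 d := by
  have hd : ∀ i ≤ 7, d i = 2 ∨ d i = 3 := fun i hi => by have := hA.1 i hi; omega
  let d' : ℕ → ℕ := fun i => if i = 0 ∨ 7 ≤ i then d i else 3
  have hd' : ∀ i ≤ 7, (d' i = 2 ∨ d' i = 3) ∧ d i ≤ d' i := by
    intro i hi
    have := hd i hi
    simp only [d']
    split_ifs <;> omega
  refine Col_of_raise (d' := d') (fun i hi => (hA.1 i hi).1) (fun i hi => (hd' i hi).2)
    (by simp [d']) (by simp [d']) ?_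
  refine base (ends := [2, 3]) (ints := [3]) (by norm_num) (by norm_num) chk5 ?_ ?_ ?_ ?_ ?_
  · intro j hj
    exact masksOK5 _ (by simpa using (hd' j hj).1)
  · intro j hj
    have := (hd' j (by omega)).1
    have := (hd' (j + 1) (by omega)).1
    omega
  · simpa using (hd' 0 (by omega)).1
  · simpa using (hd' 7 (by omega)).1
  · intro j h1 h2
    simp only [d']
    rw [if_neg (by omega)]
    simp

lemma Col6 {d : ℕ → ℕ} (hA : Adm 6 6 d) : Col 6 6 d := by
  have hd : ∀ i ≤ 6, d i = 2 ∨ d i = 3 ∨ d i = 4 := fun i hi => by have := hA.1 i hi; omega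
  let d' : ℕ → ℕ := fun i => if i = 0 ∨ 6 ≤ i then d i else max (d i) 3
  have hd' : ∀ i ≤ 6, (d' i = 2 ∨ d' i = 3 ∨ d' i = 4) ∧ d i ≤ d' i ∧ d' i ≤ max (d i) 3 := by
    intro i hi
    have := hd i hi
    simp only [d']
    split_ifs <;> omega
  refine Col_of_raise (d' := d') (fun i hi => (hA.1 i hi).1) (fun i hi => (hd' i hi).2.1)
    (by simp [d']) (by simp [d']) ?_
  refine base (ends := [2, 3, 4]) (ints := [3, 4]) (by norm_num) (by norm_num) chk6 ?_ ?_ ?_ ?_ ?_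
  · intro j hj
    exact masksOK6 _ (by simpa using (hd' j hj).1)
  · intro j hj
    have := (hd' j (by omega)).2
    have := (hd' (j + 1) (by omega)).2
    have := hA.2 j hj
    have := hA.1 j (by omega)
    have := hA.1 (j + 1) (by omega)
    omega
  · simpa using (hd' 0 (by omega)).1
  · simpa using (hd' 6 (by omega)).1
  · intro j h1 h2
    have := hd j (by omega)
    simp only [d']
    rw [if_neg (by omega)]
    simp only [List.mem_cons, List.not_mem_nil, or_false]
    omega

/-- Extending in the length. -/
lemma Col_length {k n0 : ℕ} (h : ∀ d, Adm k n0 d → Col k n0 d) :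
    ∀ n, n0 ≤ n → ∀ d, Adm k n d → Col k n d := by
  intro n hn
  induction n, hn using Nat.le_induction with
  | base => exact h
  | succ n hn ih =>
    intro d hA
    exact Col_succ hA (ih _ ⟨fun i hi => hA.1 (i + 1) (by omega),
      fun i hi => hA.2 (i + 1) (by omega)⟩)

lemma Col_main6 : ∀ k, 6 ≤ k → ∀ n, 6 ≤ n → k ≤ n + 1 → ∀ d, Adm k n d → Col k n d := by
  intro k hk
  induction k, hk using Nat.le_induction with
  | base => exact fun n hn _ => Col_length (fun d => Col6) n hn
  | succ k hk ih =>
    intro n hn hkn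
    refine Col_length (n0 := k) (fun d hA => ?_) n (by omega)
    exact Col_color_step hk (Or.inr rfl) (ih k hk (by omega)) hA

lemma Col_main {k n : ℕ} (hk : 5 ≤ k) (hn : (if k = 5 then 8 else if k ≤ 7 then 7 else k) ≤ n + 1)
    {d : ℕ → ℕ} (hA : Adm k n d) {κ : ℕ} (hκ : k ≤ κ) : Col κ n d := by
  have h2 : 2 ≤ n := by split_ifs at hn <;> omega
  refine Col_more hk h2 (fun d hA => ?_) κ hκ d hA
  by_cases h5 : k = 5
  · subst h5
    exact Col_length (fun d => Col5) n (by simp at hn; omega) d hA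
  · refine Col_main6 k (by omega) n ?_ ?_ d hA <;>
    · split_ifs at hn <;> omega

lemma Cat_adj_ll {ℓ : ℕ} {d : ℕ → ℕ} {i j : Fin (ℓ + 2)} :
    (Cat ℓ d).Adj (Sum.inl i) (Sum.inl j) ↔ (j : ℕ) = i + 1 ∨ (i : ℕ) = j + 1 := by
  simp only [Cat, SimpleGraph.fromRel_adj, CatRel]
  constructor
  · rintro ⟨_, h⟩; exact h
  · intro h
    refine ⟨?_, h⟩
    rintro h'
    have := Sum.inl.inj h'
    subst this
    omega

lemma Cat_adj_rl {ℓ : ℕ} {d : ℕ → ℕ} {p : Σ i : Fin ℓ, Fin (d (i.val + 1) - 2)}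
    {j : Fin (ℓ + 2)} :
    (Cat ℓ d).Adj (Sum.inr p) (Sum.inl j) ↔ (j : ℕ) = (p.1 : ℕ) + 1 := by
  simp [Cat, SimpleGraph.fromRel_adj, CatRel]

lemma Cat_adj_lr {ℓ : ℕ} {d : ℕ → ℕ} {p : Σ i : Fin ℓ, Fin (d (i.val + 1) - 2)}
    {j : Fin (ℓ + 2)} :
    (Cat ℓ d).Adj (Sum.inl j) (Sum.inr p) ↔ (j : ℕ) = (p.1 : ℕ) + 1 := by
  rw [SimpleGraph.adj_comm, Cat_adj_rl]

lemma Cat_adj_rr {ℓ : ℕ} {d : ℕ → ℕ} {p q : Σ i : Fin ℓ, Fin (d (i.val + 1) - 2)} :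
    ¬ (Cat ℓ d).Adj (Sum.inr p) (Sum.inr q) := by
  simp [Cat, SimpleGraph.fromRel_adj, CatRel]

/-- The spine edge `x_i x_{i+1}`. -/
def sE (ℓ : ℕ) (d : ℕ → ℕ) (i : ℕ) (h : i < ℓ + 1) : Sym2 (CatV ℓ d) :=
  s(Sum.inl ⟨i, by omega⟩, Sum.inl ⟨i + 1, by omega⟩)

/-- The leaf edge at the leaf `p`. -/
def lE (ℓ : ℕ) (d : ℕ → ℕ) (p : Σ i : Fin ℓ, Fin (d (i.val + 1) - 2)) : Sym2 (CatV ℓ d) :=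
  s(Sum.inr p, Sum.inl ⟨p.1 + 1, by omega⟩)

lemma Cat_edge {ℓ : ℕ} {d : ℕ → ℕ} {e : Sym2 (CatV ℓ d)} (he : e ∈ (Cat ℓ d).edgeSet) :
    (∃ i h, e = sE ℓ d i h) ∨ ∃ p, e = lE ℓ d p := by
  induction e using Sym2.ind with
  | _ x y =>
    rw [SimpleGraph.mem_edgeSet] at he
    rcases x with i | p <;> rcases y with j | q
    · rw [Cat_adj_ll] at he
      obtain ⟨i, hi⟩ := i
      obtain ⟨j, hj⟩ := j
      simp only at he
      rcases he with rfl | rfl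
      · exact Or.inl ⟨i, by omega, rfl⟩
      · exact Or.inl ⟨j, by omega, Sym2.eq_swap⟩
    · rw [Cat_adj_lr] at he
      obtain ⟨i, hi⟩ := i
      simp only at he
      subst he
      exact Or.inr ⟨q, Sym2.eq_swap⟩
    · rw [Cat_adj_rl] at he
      obtain ⟨i, hi⟩ := j
      simp only at he
      subst he
      exact Or.inr ⟨p, rfl⟩
    · exact absurd he Cat_adj_rr

lemma sE_mem {ℓ : ℕ} {d : ℕ → ℕ} {i : ℕ} (h : i < ℓ + 1) : sE ℓ d i h ∈ (Cat ℓ d).edgeSet := by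
  unfold sE
  rw [SimpleGraph.mem_edgeSet, Cat_adj_ll]
  exact Or.inl rfl

lemma lE_mem {ℓ : ℕ} {d : ℕ → ℕ} (p) : lE ℓ d p ∈ (Cat ℓ d).edgeSet := by
  unfold lE
  rw [SimpleGraph.mem_edgeSet, Cat_adj_rl]

/-- Color of a pair of vertices. -/
def catc (ℓ : ℕ) (d : ℕ → ℕ) (b : ℕ → ℕ) (g : (Σ i : Fin ℓ, Fin (d (i.val + 1) - 2)) → ℕ) :
    CatV ℓ d → CatV ℓ d → ℕ
  | Sum.inl i, Sum.inl j => b (min (i : ℕ) j)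
  | Sum.inr p, Sum.inl _ => g p
  | Sum.inl _, Sum.inr p => g p
  | Sum.inr _, Sum.inr _ => 0

def catφ (ℓ : ℕ) (d : ℕ → ℕ) (b : ℕ → ℕ) (g : (Σ i : Fin ℓ, Fin (d (i.val + 1) - 2)) → ℕ) :
    Sym2 (CatV ℓ d) → ℕ :=
  Sym2.lift ⟨catc ℓ d b g, by
    rintro (i | p) (j | q)
    · simp only [catc]; rw [min_comm]
    · rfl
    · rfl
    · rfl⟩

lemma catφ_sE {ℓ : ℕ} {d b : ℕ → ℕ} {g} {i : ℕ} (h : i < ℓ + 1) :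
    catφ ℓ d b g (sE ℓ d i h) = b i := by
  simp [catφ, sE, catc]

lemma catφ_lE {ℓ : ℕ} {d b : ℕ → ℕ} {g} (p) : catφ ℓ d b g (lE ℓ d p) = g p := by
  simp [catφ, lE, catc]

lemma near_symm {V : Type*} {G : SimpleGraph V} {e f : Sym2 V} (h : EdgesNear G e f) :
    EdgesNear G f e := by
  obtain ⟨u, v, hu, hv, h⟩ := h
  exact ⟨v, u, hv, hu, h.imp Eq.symm fun h => h.symm⟩

lemma near_ss {ℓ : ℕ} {d : ℕ → ℕ} {i j : ℕ} {hi : i < ℓ + 1} {hj : j < ℓ + 1}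
    (h : EdgesNear (Cat ℓ d) (sE ℓ d i hi) (sE ℓ d j hj)) : i ≤ j + 2 ∧ j ≤ i + 2 := by
  obtain ⟨u, v, hu, hv, h⟩ := h
  simp only [sE, Sym2.mem_iff] at hu hv
  rcases hu with rfl | rfl <;> rcases hv with rfl | rfl <;>
    simp only [Cat_adj_ll, Sum.inl.injEq, Fin.mk.injEq] at h <;> omega

lemma near_sl {ℓ : ℕ} {d : ℕ → ℕ} {i : ℕ} {hi : i < ℓ + 1} {p}
    (h : EdgesNear (Cat ℓ d) (sE ℓ d i hi) (lE ℓ d p)) :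
    i ≤ (p.1 : ℕ) + 2 ∧ (p.1 : ℕ) ≤ i + 1 := by
  obtain ⟨u, v, hu, hv, h⟩ := h
  simp only [sE, lE, Sym2.mem_iff] at hu hv
  rcases hu with rfl | rfl <;> rcases hv with rfl | rfl <;>
    simp only [Cat_adj_ll, Cat_adj_lr, Sum.inl.injEq, Fin.mk.injEq, reduceCtorEq,
      false_or] at h <;> omega

lemma near_ll {ℓ : ℕ} {d : ℕ → ℕ} {p q}
    (h : EdgesNear (Cat ℓ d) (lE ℓ d p) (lE ℓ d q)) :
    (p.1 : ℕ) ≤ (q.1 : ℕ) + 1 ∧ (q.1 : ℕ) ≤ (p.1 : ℕ) + 1 := by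
  obtain ⟨u, v, hu, hv, h⟩ := h
  simp only [lE, Sym2.mem_iff] at hu hv
  rcases hu with rfl | rfl <;> rcases hv with rfl | rfl <;>
    simp only [Cat_adj_ll, Cat_adj_lr, Cat_adj_rl, Cat_adj_rr, Sum.inl.injEq, Sum.inr.injEq,
      Fin.mk.injEq, reduceCtorEq, or_false, false_or] at h
  · subst h; omega
  all_goals omega

lemma mem_sE {ℓ : ℕ} {d : ℕ → ℕ} {i j : ℕ} {hi : i < ℓ + 1} {hj : j < ℓ + 2} :
    (Sum.inl ⟨j, hj⟩ : CatV ℓ d) ∈ sE ℓ d i hi ↔ j = i ∨ j = i + 1 := by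
  simp [sE]

lemma mem_lE {ℓ : ℕ} {d : ℕ → ℕ} {j : ℕ} {p} {hj : j < ℓ + 2} :
    (Sum.inl ⟨j, hj⟩ : CatV ℓ d) ∈ lE ℓ d p ↔ j = (p.1 : ℕ) + 1 := by
  simp [lE]

lemma precolor_of_Ex {n : ℕ} {d : ℕ → ℕ} {C C₁ Cl : Finset ℕ} {α₀ αl : ℕ}
    (h : Ex C n (fun i => d (i + 1)) C₁ α₀ Cl αl) (h0 : α₀ ∈ C₁) (hl : αl ∈ Cl) :
    CatPrecolorExists (n + 1) d C C₁ Cl α₀ αl := by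
  obtain ⟨S, b, rfl, rfl, rfl, rfl, h5, h6, h7⟩ := h
  have hR : ∀ i ≤ n, b (i + 1) ∈ S i := by
    intro i hi
    rcases Nat.lt_or_ge i n with h | h
    · have : b (i + 1) ∈ S i ∩ S (i + 1) := by rw [h6 i h]; simp
      exact (Finset.mem_inter.1 this).1
    · obtain rfl : i = n := by omega
      exact hl
  have hL : ∀ i ≤ n, b i ∈ S i := by
    rintro (_ | i) hi
    · exact h0
    · have : b (i + 1) ∈ S i ∩ S (i + 1) := by rw [h6 i (by omega)]; simp
      exact (Finset.mem_inter.1 this).2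
  have hI : ∀ i < n, ∀ c, c ∈ S i → c ∈ S (i + 1) → c = b (i + 1) := by
    intro i hi c h1 h2
    have : c ∈ S i ∩ S (i + 1) := Finset.mem_inter.2 ⟨h1, h2⟩
    rw [h6 i hi] at this
    simpa using this
  have hg : ∀ i : Fin (n + 1), ∃ g : Fin (d (i.val + 1) - 2) → ℕ, Function.Injective g ∧
      ∀ c, (∃ t, g t = c) ↔ c ∈ S i ∧ c ≠ b i ∧ c ≠ b (i + 1) := by
    intro i
    have hi : (i : ℕ) ≤ n := by omega
    have hc : (((S i).erase (b i)).erase (b (i + 1))).card = d (i.val + 1) - 2 := by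
      rw [Finset.card_erase_of_mem, Finset.card_erase_of_mem (hL i hi), (h5 i hi).2]
      · simp only; omega
      · exact Finset.mem_erase.2 ⟨(h7 i hi).symm, hR i hi⟩
    refine ⟨fun t => ((Finset.equivFinOfCardEq hc).symm t : ℕ), ?_, ?_⟩
    · intro s t hst
      exact (Finset.equivFinOfCardEq hc).symm.injective (Subtype.ext hst)
    · intro c
      constructor
      · rintro ⟨t, rfl⟩
        have := ((Finset.equivFinOfCardEq hc).symm t).2
        simp only [Finset.mem_erase] at this
        exact ⟨this.2.2, this.2.1, this.1⟩
      · rintro ⟨h1, h2, h3⟩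
        refine ⟨Finset.equivFinOfCardEq hc ⟨c, ?_⟩, ?_⟩
        · simp only [Finset.mem_erase]; exact ⟨h3, h2, h1⟩
        · simp
  choose G hGi hGm using hg
  let g : (Σ i : Fin (n + 1), Fin (d (i.val + 1) - 2)) → ℕ := fun p => G p.1 p.2
  have hgS : ∀ p, g p ∈ S p.1 ∧ g p ≠ b p.1 ∧ g p ≠ b (p.1 + 1) :=
    fun p => (hGm p.1 (g p)).1 ⟨p.2, rfl⟩
  have himg : ∀ i (hi : i < n + 1),
      catφ (n + 1) d b g '' Einc (Cat (n + 1) d) (Sum.inl ⟨i + 1, by omega⟩) = ↑(S i) := by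
    intro i hi
    ext c
    constructor
    · rintro ⟨e, ⟨he, hm⟩, rfl⟩
      rcases Cat_edge he with ⟨j, hj, rfl⟩ | ⟨p, rfl⟩
      · rw [mem_sE] at hm
        rw [catφ_sE]
        rcases hm with rfl | hm
        · exact hR i (by omega)
        · obtain rfl : i = j := by omega
          exact hL i (by omega)
      · rw [mem_lE] at hm
        rw [catφ_lE]
        obtain rfl : i = p.1 := by omega
        exact (hgS p).1
    · intro hc
      by_cases h1 : c = b i
      · refine ⟨sE _ d i (by omega), ⟨sE_mem _, ?_⟩, ?_⟩
        · rw [mem_sE]; omega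
        · rw [catφ_sE, h1]
      by_cases h2 : c = b (i + 1)
      · refine ⟨sE _ d (i + 1) (by omega), ⟨sE_mem _, ?_⟩, ?_⟩
        · rw [mem_sE]; omega
        · rw [catφ_sE, h2]
      obtain ⟨t, ht⟩ := (hGm ⟨i, hi⟩ c).2 ⟨hc, h1, h2⟩
      refine ⟨lE _ d ⟨⟨i, hi⟩, t⟩, ⟨lE_mem _, ?_⟩, ?_⟩
      · rw [mem_lE]
      · rw [catφ_lE]; exact ht
  have hss : ∀ i j, i < j → j ≤ i + 2 → j < n + 2 → b i ≠ b j := by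
    intro i j h1 h2 h3 h
    rcases Nat.lt_or_ge j (i + 2) with h' | h'
    · obtain rfl : j = i + 1 := by omega
      exact h7 i (by omega) h
    · obtain rfl : j = i + 2 := by omega
      have := hI i (by omega) (b i) (hL i (by omega)) (by rw [h]; exact hR (i + 1) (by omega))
      exact h7 i (by omega) this
  have hsl : ∀ i p, i < n + 2 → i ≤ (p.1 : ℕ) + 2 → (p.1 : ℕ) ≤ i + 1 → b i ≠ g p := by
    intro i p hi h1 h2 h
    obtain ⟨a1, a2, a3⟩ := hgS p
    have hp := p.1.2
    generalize (p.1 : ℕ) = q at *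
    rcases Nat.lt_trichotomy i q with h' | h' | h'
    · obtain rfl : q = i + 1 := by omega
      have := hI i (by omega) (g p) (by rw [← h]; exact hL i (by omega)) a1
      exact a2 this
    · subst h'; exact a2 h.symm
    · rcases Nat.lt_or_ge i (q + 2) with h'' | h''
      · obtain rfl : i = q + 1 := by omega
        exact a3 h.symm
      · obtain rfl : i = q + 2 := by omega
        have := hI q (by omega) (g p) a1 (by rw [← h]; exact hR (q + 1) (by omega))
        exact a3 this
  have hll : ∀ p q, (q.1 : ℕ) = (p.1 : ℕ) + 1 → g p ≠ g q := by
    intro p q hpq h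
    have a := (hgS q).1
    have hq := q.1.2
    rw [hpq, ← h] at a
    exact (hgS p).2.2 (hI p.1 (by omega) _ (hgS p).1 a)
  refine ⟨catφ (n + 1) d b g, ?_, ?_, himg 0 (by omega), himg n (by omega), ?_, ?_⟩
  · intro e he
    rcases Cat_edge he with ⟨j, hj, rfl⟩ | ⟨p, rfl⟩
    · rw [catφ_sE]
      rcases Nat.lt_or_ge j (n + 1) with h | h
      · exact (h5 j (by omega)).1 (hL j (by omega))
      · obtain rfl : j = n + 1 := by omega
        exact (h5 n le_rfl).1 (hR n le_rfl)
    · rw [catφ_lE]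
      exact (h5 p.1 (by omega)).1 (hgS p).1
  · intro e he f hf hne hnear
    rcases Cat_edge he with ⟨i, hi, rfl⟩ | ⟨p, rfl⟩ <;>
      rcases Cat_edge hf with ⟨j, hj, rfl⟩ | ⟨q, rfl⟩
    · rw [catφ_sE, catφ_sE]
      have := near_ss hnear
      rcases Nat.lt_trichotomy i j with h | h | h
      · exact hss i j h (by omega) (by omega)
      · subst h; exact absurd rfl hne
      · exact (hss j i h (by omega) (by omega)).symm
    · rw [catφ_sE, catφ_lE]
      have := near_sl hnear
      exact hsl i q hi this.1 this.2
    · rw [catφ_sE, catφ_lE]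
      have := near_sl (near_symm hnear)
      exact (hsl j p hj this.1 this.2).symm
    · rw [catφ_lE, catφ_lE]
      have := near_ll hnear
      rcases Nat.lt_trichotomy p.1 q.1 with h | h | h
      · exact hll p q (by omega)
      · obtain ⟨p1, p2⟩ := p
        obtain ⟨q1, q2⟩ := q
        obtain rfl : p1 = q1 := Fin.ext h
        intro hh
        have := hGi _ hh
        subst this
        exact hne rfl
      · exact (hll q p (by omega)).symm
  · exact catφ_sE (i := 0) (by omega)
  · exact catφ_sE (i := n + 1) (by omega)

lemma le_ndeg {ℓ : ℕ} {d : ℕ → ℕ} (hd : ∀ i, 1 ≤ i → i ≤ ℓ → 2 ≤ d i) (i : ℕ) (hi : i < ℓ) :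
    d (i + 1) ≤ ndeg (Cat ℓ d) (Sum.inl ⟨i + 1, by omega⟩) := by
  let f : Option (Option (Fin (d (i + 1) - 2))) →
      (Cat ℓ d).neighborSet (Sum.inl ⟨i + 1, by omega⟩) := fun o =>
    match o with
    | none => ⟨Sum.inl ⟨i, by omega⟩, by
        rw [SimpleGraph.mem_neighborSet, Cat_adj_ll]; exact Or.inr rfl⟩
    | some none => ⟨Sum.inl ⟨i + 2, by omega⟩, by
        rw [SimpleGraph.mem_neighborSet, Cat_adj_ll]; exact Or.inl rfl⟩
    | some (some t) => ⟨Sum.inr ⟨⟨i, hi⟩, t⟩, by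
        rw [SimpleGraph.mem_neighborSet, Cat_adj_lr]⟩
  have hf : Function.Injective f := by
    rintro (_ | _ | s) (_ | _ | t) h <;> simp [f] at h ⊢
    exact h
  have := Nat.card_le_card_of_injective f hf
  have h2 := hd (i + 1) (by omega) (by omega)
  simp only [Finite.card_option, Nat.card_fin] at this
  unfold ndeg
  rw [← Nat.card_coe_set_eq]
  omega

lemma Cat_adm {ℓ : ℕ} {d : ℕ → ℕ} (hd : ∀ i, 1 ≤ i → i ≤ ℓ → 2 ≤ d i)
    (hΔ : maxDeg (Cat ℓ d) + 2 ≤ sigmaG (Cat ℓ d)) {n : ℕ} (hn : ℓ = n + 1) :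
    Adm (sigmaG (Cat ℓ d)) n (fun i => d (i + 1)) := by
  constructor
  · intro i hi
    refine ⟨hd _ (by omega) (by omega), ?_⟩
    have h1 := le_ndeg hd i (by omega)
    have h2 : ndeg (Cat ℓ d) (Sum.inl ⟨i + 1, by omega⟩) ≤ maxDeg (Cat ℓ d) :=
      le_csSup (Set.finite_range _).bddAbove ⟨_, rfl⟩
    simp only
    omega
  · intro i hi
    have h1 := le_ndeg hd i (by omega)
    have h2 := le_ndeg hd (i + 1) (by omega)
    have h3 : ndeg (Cat ℓ d) (Sum.inl ⟨i + 1, by omega⟩) +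
        ndeg (Cat ℓ d) (Sum.inl ⟨i + 1 + 1, by omega⟩) - 1 ≤ sigmaG (Cat ℓ d) := by
      refine le_csSup ?_ ⟨_, _, ?_, rfl⟩
      · apply Set.Finite.bddAbove
        refine (Set.finite_range fun p : CatV ℓ d × CatV ℓ d =>
          ndeg (Cat ℓ d) p.1 + ndeg (Cat ℓ d) p.2 - 1).subset ?_
        rintro m ⟨x, y, _, rfl⟩
        exact ⟨(x, y), rfl⟩
      · rw [Cat_adj_ll]; exact Or.inl rfl
    simp only
    omega

theorem twoSided_of_nice_refined (ℓ : ℕ) (d : ℕ → ℕ)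
    (hd : ∀ i, 1 ≤ i → i ≤ ℓ → 2 ≤ d i)
    (h5 : 5 ≤ sigmaG (Cat ℓ d))
    (hΔ : maxDeg (Cat ℓ d) + 2 ≤ sigmaG (Cat ℓ d))
    (hl : ellSigma (sigmaG (Cat ℓ d)) ≤ ℓ)
    (κ : ℕ) (hκ : sigmaG (Cat ℓ d) ≤ κ) :
    TwoSidedPrecolorable ℓ d κ := by
  have hpos : 1 ≤ ℓ := by
    unfold ellSigma at hl
    split_ifs at hl <;> omega
  obtain ⟨n, rfl⟩ : ∃ n, ℓ = n + 1 := ⟨ℓ - 1, by omega⟩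
  have hcol := Col_main h5 hl (Cat_adm hd hΔ rfl) hκ
  intro C C₁ Cl hC h1 h2 hc1 hc2 α₀ h0 αl hαl
  exact precolor_of_Ex (hcol C C₁ Cl hC h1 h2 hc1 hc2 α₀ h0 αl hαl) h0 hαl
end

section
/- Let T = Cat(d₁, d₂, …, d_ℓ) be a caterpillar tree with σ = σ(T) ≥ 4 and ℓ ≥ ℓ_{σ+1}, where ℓ_k = 8 if k = 5, ℓ_k = 7 if k ∈ {6,7}, and ℓ_k = k if k ≥ 8. Then T is κ-two-sided strong edge-pre-colorable for every integer κ ≥ σ + 1. -/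
open SimpleGraph

/-- `GoodC C T τ ds S a`: starting from color set `S` with incoming color `a`, one can walk through
vertices with degrees `ds` and finish with color set `T` and outgoing color `τ`. -/
def GoodC (C T : Finset ℕ) (τ : ℕ) : List ℕ → Finset ℕ → ℕ → Prop
  | [], S, a => S = T ∧ a ≠ τ
  | d :: ds, S, a => ∃ b ∈ S, b ≠ a ∧ ∃ S' : Finset ℕ, S' ⊆ C ∧ S'.card = d ∧ S ∩ S' = {b} ∧
      GoodC C T τ ds S' b

/-- Degree condition along a list. -/
def OkD (k : ℕ) : ℕ → List ℕ → Prop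
  | d, [] => 2 ≤ d
  | d, d2 :: ds => 2 ≤ d ∧ d + d2 ≤ k ∧ OkD k d2 ds

/-- last element of `d :: ds`. -/
def lastD : ℕ → List ℕ → ℕ
  | d, [] => d
  | _, d2 :: ds => lastD d2 ds

/-- Removing one color from a sequence of degrees. -/
inductive LiftD : Bool → List ℕ → List ℕ → Bool → Prop
  | nil (e : Bool) : LiftD e [] [] e
  | cons0 (e f : Bool) (d : ℕ) (ds ds' : List ℕ) :
      LiftD false ds ds' f → LiftD e (d :: ds) (d :: ds') f
  | cons1 (f : Bool) (d : ℕ) (ds ds' : List ℕ) :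
      LiftD true ds ds' f → LiftD false ((d + 1) :: ds) (d :: ds') f

theorem OkD.two_le {k d : ℕ} {ds : List ℕ} (h : OkD k d ds) : 2 ≤ d := by
  cases ds <;> simp_all [OkD]

theorem OkD.last_two {k d : ℕ} {ds : List ℕ} (h : OkD k d ds) : 2 ≤ lastD d ds := by
  induction ds generalizing d with
  | nil => simpa [OkD, lastD] using h
  | cons d2 ds ih => exact ih h.2.2

theorem OkD.last_le {k d d2 : ℕ} {ds : List ℕ} (h : OkD k d (d2 :: ds)) :
    lastD d (d2 :: ds) + 2 ≤ k := by
  induction ds generalizing d d2 with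
  | nil => simp only [OkD, lastD] at *; omega
  | cons d3 ds ih => exact ih h.2.2

theorem lift_exists (k : ℕ) (ds : List ℕ) : ∀ d, OkD (k + 1) d ds →
    (d + 2 ≤ k → ∃ ds' f, LiftD false ds ds' f ∧ ds'.length = ds.length ∧ OkD k d ds' ∧
      lastD d ds = lastD d ds' + f.toNat) ∧
    (3 ≤ d → ∃ ds' f, LiftD true ds ds' f ∧ ds'.length = ds.length ∧ OkD k (d - 1) ds' ∧
      lastD d ds = lastD (d - 1) ds' + f.toNat) := by
  induction ds with
  | nil =>
    intro d h
    simp only [OkD] at h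
    refine ⟨fun _ => ⟨[], false, .nil _, rfl, h, rfl⟩, fun h3 => ⟨[], true, .nil _, rfl, ?_, ?_⟩⟩
    · simp only [OkD]; omega
    · simp only [lastD, Bool.toNat_true]; omega
  | cons d2 ds ih =>
    intro d h
    obtain ⟨h2, hs, hk⟩ := h
    obtain ⟨ih0, ih1⟩ := ih d2 hk
    have := hk.two_le
    refine ⟨fun hd => ?_, fun hd => ?_⟩
    · by_cases ht : d + d2 ≤ k
      · obtain ⟨ds', f, hl, hlen, hok, hlast⟩ := ih0 (by omega)
        exact ⟨d2 :: ds', f, .cons0 _ _ _ _ _ hl, by simp [hlen], ⟨h2, ht, hok⟩, hlast⟩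
      · obtain ⟨ds', f, hl, hlen, hok, hlast⟩ := ih1 (by omega)
        refine ⟨(d2 - 1) :: ds', f, ?_, by simp [hlen], ⟨h2, by omega, hok⟩, hlast⟩
        have := LiftD.cons1 f (d2 - 1) ds ds' hl
        rwa [Nat.sub_add_cancel (by omega)] at this
    · obtain ⟨ds', f, hl, hlen, hok, hlast⟩ := ih0 (by omega)
      exact ⟨d2 :: ds', f, .cons0 _ _ _ _ _ hl, by simp [hlen], ⟨by omega, by omega, hok⟩, hlast⟩

theorem lift_good {C T : Finset ℕ} {τ τ' c : ℕ} (hc : c ∈ C) {e f : Bool} {ds ds' : List ℕ}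
    (hl : LiftD e ds ds' f) (hf : c ∈ T ↔ f = true) (hτ : τ' = τ ∨ τ = c) :
    ∀ S a a', c ∉ S → ((a' = a ∧ a ≠ c) ∨ (a = c ∧ ds ≠ [])) →
      GoodC (C.erase c) (T.erase c) τ' ds' S a' →
      GoodC C T τ ds (if e then insert c S else S) a := by
  induction hl with
  | nil e =>
    intro S a a' hcS ha hg
    obtain ⟨rfl, hne⟩ := hg
    rcases ha with ⟨rfl, ha⟩ | ⟨_, h⟩
    · refine ⟨?_, ?_⟩
      · split_ifs with he
        · exact Finset.insert_erase (hf.2 he)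
        · exact Finset.erase_eq_of_notMem (fun h => he (hf.1 h))
      · rcases hτ with rfl | rfl
        · exact hne
        · exact ha
    · exact absurd rfl h
  | cons0 e f d ds ds' hl ih =>
    intro S a a' hcS ha hg
    obtain ⟨b, hb, hba, S', hS', hcard, hint, hg⟩ := hg
    have hbc : b ≠ c := fun h => hcS (h ▸ hb)
    have hcS' : c ∉ S' := fun h => by simpa using hS' h
    have := ih hf S' b b hcS' (Or.inl ⟨rfl, hbc⟩) hg
    refine ⟨b, ?_, ?_, S', hS'.trans (Finset.erase_subset _ _), hcard, ?_, by simpa using this⟩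
    · split_ifs <;> simp [hb]
    · rcases ha with ⟨rfl, _⟩ | ⟨rfl, _⟩
      · exact hba
      · exact hbc
    · split_ifs
      · rw [Finset.insert_inter_of_notMem hcS', hint]
      · exact hint
  | cons1 f d ds ds' hl ih =>
    intro S a a' hcS ha hg
    obtain ⟨b, hb, hba, S', hS', hcard, hint, hg⟩ := hg
    have hbc : b ≠ c := fun h => hcS (h ▸ hb)
    have hcS' : c ∉ S' := fun h => by simpa using hS' h
    have := ih hf S' b b hcS' (Or.inl ⟨rfl, hbc⟩) hg
    refine ⟨b, by simpa using hb, ?_, insert c S', ?_, ?_, ?_, by simpa using this⟩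
    · rcases ha with ⟨rfl, _⟩ | ⟨rfl, _⟩
      · exact hba
      · exact hbc
    · exact Finset.insert_subset hc (hS'.trans (Finset.erase_subset _ _))
    · rw [Finset.card_insert_of_notMem hcS', hcard]
    · simp only [Bool.false_eq_true, if_false]
      rw [Finset.inter_insert_of_notMem hcS, hint]

/-- one greedy step with prescribed outgoing color, containing `R` and avoiding `c`. -/
theorem step_exists {C S R F : Finset ℕ} {b d : ℕ} (hb : b ∈ S) (hS : S ⊆ C) (hR : R ⊆ (C \ S) \ F)
    (hd : 1 ≤ d) (hRd : R.card + 1 ≤ d) (hle : d - 1 ≤ ((C \ S) \ F).card) (hbF : b ∉ F) :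
    ∃ S' ⊆ C, S'.card = d ∧ S ∩ S' = {b} ∧ R ⊆ S' ∧ Disjoint S' F := by
  obtain ⟨X, hRX, hX, hXc⟩ := Finset.exists_subsuperset_card_eq hR (n := d - 1) (by omega) hle
  have hbX : b ∉ X := fun h => by
    have := hX h; simp at this; exact this.1.2 hb
  refine ⟨insert b X, ?_, ?_, ?_, ?_, ?_⟩
  · intro y hy
    rcases Finset.mem_insert.1 hy with rfl | hy
    · exact hS hb
    · have := hX hy; simp at this; exact this.1.1
  · rw [Finset.card_insert_of_notMem hbX]; omega
  · ext y
    simp only [Finset.mem_inter, Finset.mem_insert, Finset.mem_singleton]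
    constructor
    · rintro ⟨hy, rfl | h⟩
      · rfl
      · have := hX h; simp at this; exact absurd hy this.1.2
    · rintro rfl; exact ⟨hb, Or.inl rfl⟩
  · exact hRX.trans (Finset.subset_insert _ _)
  · rw [Finset.disjoint_left]
    intro y hy
    rcases Finset.mem_insert.1 hy with rfl | hy
    · exact hbF
    · have := hX hy; simp at this; exact this.2

theorem exists_color {C T : Finset ℕ} (hT : T ⊆ C) (h2 : 2 ≤ T.card) (hC : T.card + 2 ≤ C.card)
    (f : Bool) (v : ℕ) : ∃ c ∈ C, c ≠ v ∧ (c ∈ T ↔ f = true) := by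
  cases f
  · have : 1 < (C \ T).card := by rw [Finset.card_sdiff_of_subset hT]; omega
    obtain ⟨c, hc, hcv⟩ := Finset.exists_mem_ne this v
    simp at hc
    exact ⟨c, hc.1, hcv, by simp [hc.2]⟩
  · obtain ⟨c, hc, hcv⟩ := Finset.exists_mem_ne (show 1 < T.card by omega) v
    exact ⟨c, hT hc, hcv, by simp [hc]⟩

/-- The main claim for a given number `k` of colors. -/
def MainK (k : ℕ) : Prop :=
  ∀ (C S T : Finset ℕ) (a τ : ℕ) (ds : List ℕ), C.card = k → S ⊆ C → T ⊆ C → a ∈ S → τ ∈ T →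
    k ≤ ds.length + 1 → OkD k S.card ds → lastD S.card ds = T.card → GoodC C T τ ds S a

theorem main_succ (k : ℕ) (hk : 5 ≤ k) (ih : MainK k) : MainK (k + 1) := by
  intro C S T a τ ds hC hS hT ha hτ hlen hok hlast
  cases ds with
  | nil => simp at hlen; omega
  | cons d2 ds =>
  have hTle := hok.last_le
  have hT2 := hok.last_two
  rw [hlast] at hTle hT2
  obtain ⟨hS2, hsum, hok2⟩ := hok
  have hd2 := hok2.two_le
  simp only [List.length_cons] at hlen
  change lastD d2 ds = T.card at hlast
  have hCS : (C \ S).card = k + 1 - S.card := by rw [Finset.card_sdiff_of_subset hS, hC]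
  have key : ∃ c ∈ C, ∃ e f ds', LiftD e ds ds' f ∧ ds'.length = ds.length ∧
      OkD k (d2 - e.toNat) ds' ∧ lastD d2 ds = lastD (d2 - e.toNat) ds' + f.toNat ∧
      (c ∈ T ↔ f = true) ∧ ∃ b ∈ S, b ≠ a ∧ ∃ S' ⊆ C, S'.card = d2 ∧ S ∩ S' = {b} ∧
      (c ∈ S' ↔ e = true) := by
    by_cases h : d2 + 2 ≤ k
    · obtain ⟨ds', f, hl, hlen', hok', hlast'⟩ := (lift_exists k ds d2 hok2).1 h
      obtain ⟨b, hb, hba⟩ := Finset.exists_mem_ne (show 1 < S.card by omega) a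
      obtain ⟨c, hc, hcb, hcT⟩ := exists_color hT hT2 (by omega) f b
      obtain ⟨S', hS', hcard, hint, -, hdis⟩ := step_exists (C := C) (S := S) (R := ∅) (F := {c})
        (d := d2) hb hS (by simp) (by omega) (by simp; omega) (by
          have := Finset.le_card_sdiff {c} (C \ S)
          simp only [Finset.card_singleton] at this; omega) (by simpa using hcb.symm)
      refine ⟨c, hc, false, f, ds', hl, hlen', hok', hlast', hcT, b, hb, hba, S', hS', hcard, hint, ?_⟩
      simpa using hdis
    · obtain ⟨ds', f, hl, hlen', hok', hlast'⟩ := (lift_exists k ds d2 hok2).2 (by omega)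
      obtain ⟨c, hc, hca, hcT⟩ := exists_color hT hT2 (by omega) f a
      refine ⟨c, hc, true, f, ds', hl, hlen', hok', hlast', hcT, ?_⟩
      by_cases hcS : c ∈ S
      · obtain ⟨S', hS', hcard, hint, -, -⟩ := step_exists (C := C) (S := S) (R := ∅) (F := ∅)
          (d := d2) hcS hS (by simp) (by omega) (by simp; omega) (by simp; omega) (by simp)
        refine ⟨c, hcS, hca, S', hS', hcard, hint, ?_⟩
        have : c ∈ S ∩ S' := by rw [hint]; simp
        simpa using (Finset.mem_inter.1 this).2
      · obtain ⟨b, hb, hba⟩ := Finset.exists_mem_ne (show 1 < S.card by omega) a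
        obtain ⟨S', hS', hcard, hint, hR, -⟩ := step_exists (C := C) (S := S) (R := {c}) (F := ∅)
          (d := d2) hb hS (by simp [hc, hcS]) (by omega) (by simp; omega) (by simp; omega) (by simp)
        exact ⟨b, hb, hba, S', hS', hcard, hint, by simpa using hR⟩
  obtain ⟨c, hc, e, f, ds', hl, hlen', hok', hlast', hcT, b, hb, hba, S', hS', hcard, hint, hcS'⟩ := key
  refine ⟨b, hb, hba, S', hS', hcard, hint, ?_⟩
  have hSc : (S'.erase c).card = d2 - e.toNat := by
    cases e
    · rw [Finset.erase_eq_of_notMem (by simpa using hcS')]; simpa using hcard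
    · rw [Finset.card_erase_of_mem (by simpa using hcS')]; simp [hcard]
  have hTc : (T.erase c).card + f.toNat = T.card := by
    cases f
    · rw [Finset.erase_eq_of_notMem (by simpa using hcT)]; simp
    · rw [Finset.card_erase_of_mem (by simpa using hcT)]; simp; omega
  have hbS' : b ∈ S' := by
    have : b ∈ S ∩ S' := by rw [hint]; simp
    exact (Finset.mem_inter.1 this).2
  have h1 := hok'.two_le
  have h2 := hok'.last_two
  have hds : ds ≠ [] := by rintro rfl; simp at hlen; omega
  obtain ⟨τ', hτ', hττ⟩ : ∃ τ' ∈ T.erase c, τ' = τ ∨ τ = c := by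
    by_cases h : τ = c
    · obtain ⟨x, hx⟩ := Finset.card_pos.1 (show 0 < (T.erase c).card by omega)
      exact ⟨x, hx, Or.inr h⟩
    · exact ⟨τ, by simp [h, hτ], Or.inl rfl⟩
  obtain ⟨b', hb', hbb⟩ : ∃ b' ∈ S'.erase c, (b' = b ∧ b ≠ c) ∨ (b = c ∧ ds ≠ []) := by
    by_cases h : b = c
    · obtain ⟨x, hx⟩ := Finset.card_pos.1 (show 0 < (S'.erase c).card by omega)
      exact ⟨x, hx, Or.inr ⟨h, hds⟩⟩
    · exact ⟨b, by simp [h, hbS'], Or.inl ⟨rfl, h⟩⟩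
  have hg := ih (C.erase c) (S'.erase c) (T.erase c) b' τ' ds'
    (by rw [Finset.card_erase_of_mem hc, hC]; rfl) (Finset.erase_subset_erase _ hS')
    (Finset.erase_subset_erase _ hT) hb' hτ' (by omega) (by rw [hSc]; exact hok')
    (by rw [hSc]; omega)
  have := lift_good hc hl hcT hττ (S'.erase c) b b' (by simp) hbb hg
  convert this using 1
  cases e
  · simp [Finset.erase_eq_of_notMem (show c ∉ S' by simpa using hcS')]
  · simp [Finset.insert_erase (show c ∈ S' by simpa using hcS')]

/-- Numerical version of `GoodC`: only the number of colors of each of the three classes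
`T \ {τ}`, `{τ}`, `C \ T` and the class of the last color matter. -/
def numG (n0 n2 : ℕ) : List ℕ → ℕ → ℕ → ℕ → ℕ → Bool
  | [], p, t, q, w => p == n0 && t == 1 && q == 0 && w == 0
  | d :: ds, p, t, q, w =>
    (List.range (n0 - p + 1)).any fun x => (List.range (1 - t + 1)).any fun y =>
      decide (x + y + 1 ≤ d) && (decide (d - 1 - x - y ≤ n2 - q) &&
        ((decide ((if w = 0 then 2 else 1) ≤ p) && numG n0 n2 ds (x + 1) y (d - 1 - x - y) 0) ||
        ((decide ((if w = 1 then 2 else 1) ≤ t) && numG n0 n2 ds x (y + 1) (d - 1 - x - y) 1) ||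
        (decide ((if w = 2 then 2 else 1) ≤ q) && numG n0 n2 ds x y (d - 1 - x - y + 1) 2))))

/-- Check of all starting states for one degree sequence. -/
def numCheck (s d1 d2 d3 d4 : ℕ) : Bool :=
  (List.range 4).all fun p => (List.range 2).all fun t => (List.range 4).all fun q =>
  (List.range 3).all fun w => decide (
    p + t + q = s ∧ p ≤ d4 - 1 ∧ q ≤ 5 - d4 ∧
    (w = 0 → 1 ≤ p) ∧ (w = 1 → 1 ≤ t) ∧ (w = 2 → 1 ≤ q) →
    numG (d4 - 1) (5 - d4) [d1, d2, d3, d4] p t q w = true)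

/-- Check of all degree sequences. -/
def numCheckAll : Bool :=
  (List.range 4).all fun s => (List.range 4).all fun d1 => (List.range 4).all fun d2 =>
  (List.range 4).all fun d3 => (List.range 4).all fun d4 => decide (
    (2 ≤ s ∧ 2 ≤ d1 ∧ 2 ≤ d2 ∧ 2 ≤ d3 ∧ 2 ≤ d4 ∧
      s + d1 ≤ 5 ∧ d1 + d2 ≤ 5 ∧ d2 + d3 ≤ 5 ∧ d3 + d4 ≤ 5) →
    numCheck s d1 d2 d3 d4 = true)

theorem num_check : numCheckAll = true := by
  decide +kernel

theorem num_base (s d1 d2 d3 d4 : ℕ) (h0 : 2 ≤ s) (h1 : 2 ≤ d1) (h2 : 2 ≤ d2) (h3 : 2 ≤ d3)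
    (h4 : 2 ≤ d4) (e0 : s + d1 ≤ 5) (e1 : d1 + d2 ≤ 5) (e2 : d2 + d3 ≤ 5) (e3 : d3 + d4 ≤ 5)
    (p t q w : ℕ) (ht : t < 2) (hs : p + t + q = s) (hp : p ≤ d4 - 1) (hq : q ≤ 5 - d4)
    (hw : w < 3) (w0 : w = 0 → 1 ≤ p) (w1 : w = 1 → 1 ≤ t) (w2 : w = 2 → 1 ≤ q) :
    numG (d4 - 1) (5 - d4) [d1, d2, d3, d4] p t q w = true := by
  have h := num_check
  simp only [numCheckAll, List.all_eq_true, List.mem_range, decide_eq_true_eq] at h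
  have := h s (by omega) d1 (by omega) d2 (by omega) d3 (by omega) d4 (by omega)
    ⟨h0, h1, h2, h3, h4, e0, e1, e2, e3⟩
  simp only [numCheck, List.all_eq_true, List.mem_range, decide_eq_true_eq] at this
  exact this p (by omega) t ht q (by omega) w hw ⟨hs, hp, hq, w0, w1, w2⟩

theorem num_step {C A0 A1 A2 S : Finset ℕ} (h01 : Disjoint A0 A1) (h02 : Disjoint A0 A2)
    (h12 : Disjoint A1 A2) (hA : A0 ∪ A1 ∪ A2 = C) (hS : S ⊆ C) {b x y z : ℕ} (hb : b ∈ S)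
    (hx : x ≤ A0.card - (S ∩ A0).card) (hy : y ≤ A1.card - (S ∩ A1).card)
    (hz : z ≤ A2.card - (S ∩ A2).card) :
    ∃ S' ⊆ C, S'.card = x + y + z + 1 ∧ S ∩ S' = {b} ∧
      (S' ∩ A0).card = x + (if b ∈ A0 then 1 else 0) ∧
      (S' ∩ A1).card = y + (if b ∈ A1 then 1 else 0) ∧
      (S' ∩ A2).card = z + (if b ∈ A2 then 1 else 0) := by
  rw [← Finset.card_sdiff] at hx hy hz
  obtain ⟨X, hX, hXc⟩ := Finset.exists_subset_card_eq hx
  obtain ⟨Y, hY, hYc⟩ := Finset.exists_subset_card_eq hy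
  obtain ⟨Z, hZ, hZc⟩ := Finset.exists_subset_card_eq hz
  simp only [Finset.subset_iff, Finset.mem_sdiff] at hX hY hZ
  rw [Finset.disjoint_left] at h01 h02 h12
  have hbX : b ∉ X := fun h => (hX h).2 hb
  have hbY : b ∉ Y := fun h => (hY h).2 hb
  have hbZ : b ∉ Z := fun h => (hZ h).2 hb
  have aux : ∀ (A U : Finset ℕ), b ∉ U → (∀ v, v ∈ insert b (X ∪ Y ∪ Z) ∧ v ∈ A ↔
      v ∈ U ∨ (v = b ∧ b ∈ A)) →
      (insert b (X ∪ Y ∪ Z) ∩ A).card = U.card + (if b ∈ A then 1 else 0) := by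
    intro A U hbU h
    split_ifs with hbA
    · rw [← Finset.card_insert_of_notMem hbU]
      congr 1
      ext v
      rw [Finset.mem_inter, h, Finset.mem_insert]; tauto
    · rw [Nat.add_zero]
      congr 1
      ext v
      rw [Finset.mem_inter, h]; tauto
  refine ⟨insert b (X ∪ Y ∪ Z), ?_, ?_, ?_, ?_, ?_, ?_⟩
  · subst hA
    intro v hv
    have := hS hb
    simp only [Finset.mem_insert, Finset.mem_union] at *
    grind
  · rw [Finset.card_insert_of_notMem (by simp [hbX, hbY, hbZ]), Finset.card_union_of_disjoint,
      Finset.card_union_of_disjoint, hXc, hYc, hZc]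
    · rw [Finset.disjoint_left]; grind
    · rw [Finset.disjoint_left]; grind
  · ext v; simp only [Finset.mem_inter, Finset.mem_insert, Finset.mem_union, Finset.mem_singleton]
    grind
  · rw [← hXc]; apply aux _ _ hbX; intro v; simp only [Finset.mem_insert, Finset.mem_union]; grind
  · rw [← hYc]; apply aux _ _ hbY; intro v; simp only [Finset.mem_insert, Finset.mem_union]; grind
  · rw [← hZc]; apply aux _ _ hbZ; intro v; simp only [Finset.mem_insert, Finset.mem_union]; grind

theorem exists_mem_inter_ne {S A : Finset ℕ} {a w i : ℕ} (h : (if w = i then 2 else 1) ≤ (S ∩ A).card)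
    (hw : a ∈ A → w = i) : ∃ b ∈ S, b ∈ A ∧ b ≠ a := by
  by_cases ha : a ∈ A
  · rw [if_pos (hw ha)] at h
    obtain ⟨b, hb, hba⟩ := Finset.exists_mem_ne (show 1 < (S ∩ A).card by omega) a
    simp at hb
    exact ⟨b, hb.1, hb.2, hba⟩
  · have : 0 < (S ∩ A).card := by split_ifs at h <;> omega
    obtain ⟨b, hb⟩ := Finset.card_pos.1 this
    simp at hb
    exact ⟨b, hb.1, hb.2, fun h => ha (h ▸ hb.2)⟩

theorem num_good {C T : Finset ℕ} {τ : ℕ} (hT : T ⊆ C) (hτ : τ ∈ T) (ds : List ℕ) :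
    ∀ (S : Finset ℕ) (a w : ℕ), S ⊆ C → a ∈ C → (a ∈ T.erase τ ↔ w = 0) → (a ∈ ({τ} : Finset ℕ) ↔ w = 1) →
      (a ∈ C \ T ↔ w = 2) →
      numG (T.card - 1) (C.card - T.card) ds (S ∩ T.erase τ).card (S ∩ {τ}).card (S ∩ (C \ T)).card w = true →
      GoodC C T τ ds S a := by
  have hA0 : (T.erase τ).card = T.card - 1 := Finset.card_erase_of_mem hτ
  have hA2 : (C \ T).card = C.card - T.card := Finset.card_sdiff_of_subset hT
  have h01 : Disjoint (T.erase τ) {τ} := by simp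
  have h02 : Disjoint (T.erase τ) (C \ T) := by
    rw [Finset.disjoint_left]; intro v; simp; tauto
  have h12 : Disjoint {τ} (C \ T) := by simp [hτ]
  have hA : T.erase τ ∪ {τ} ∪ (C \ T) = C := by
    ext v; simp only [Finset.mem_union, Finset.mem_erase, Finset.mem_singleton, Finset.mem_sdiff]
    by_cases h : v = τ
    · subst h; simp [hT hτ]
    · have := @hT v; tauto
  induction ds with
  | nil =>
    intro S a w hS ha h0 h1 h2 hn
    simp only [numG, Bool.and_eq_true, beq_iff_eq] at hn
    obtain ⟨⟨⟨hp, ht⟩, hq⟩, hw⟩ := hn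
    have e0 : S ∩ T.erase τ = T.erase τ :=
      Finset.eq_of_subset_of_card_le Finset.inter_subset_right (by omega)
    have e1 : S ∩ {τ} = {τ} :=
      Finset.eq_of_subset_of_card_le Finset.inter_subset_right (by simp [ht])
    have e2 := Finset.card_eq_zero.1 hq
    refine ⟨?_, ?_⟩
    · apply Finset.Subset.antisymm
      · intro v hv
        by_contra hvT
        have : v ∈ S ∩ (C \ T) := by simp [hv, hvT, hS hv]
        rw [e2] at this
        simp at this
      · intro v hv
        by_cases hvt : v = τ
        · have : v ∈ S ∩ {τ} := by rw [e1]; simp [hvt]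
          exact (Finset.mem_inter.1 this).1
        · have : v ∈ S ∩ T.erase τ := by rw [e0]; simp [hvt, hv]
          exact (Finset.mem_inter.1 this).1
    · have := h0.2 hw
      simp at this; exact this.1
  | cons d ds ih =>
    intro S a w hS ha h0 h1 h2 hn
    simp only [numG, List.any_eq_true, Bool.and_eq_true, Bool.or_eq_true, decide_eq_true_eq,
      List.mem_range] at hn
    obtain ⟨x, hx, y, hy, hd, hz, hn⟩ := hn
    rw [← hA0] at hx
    rw [← hA2] at hz
    have hy' : y ≤ ({τ} : Finset ℕ).card - (S ∩ {τ}).card := by simp only [Finset.card_singleton]; omega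
    have main : ∀ b ∈ S, b ≠ a → ∀ w', (b ∈ T.erase τ ↔ w' = 0) → (b ∈ ({τ} : Finset ℕ) ↔ w' = 1) →
      (b ∈ C \ T ↔ w' = 2) → numG (T.card - 1) (C.card - T.card) ds
        (x + if w' = 0 then 1 else 0) (y + if w' = 1 then 1 else 0)
        (d - 1 - x - y + if w' = 2 then 1 else 0) w' = true → GoodC C T τ (d :: ds) S a := by
      intro b hb hba w' e0 e1 e2 hnum
      obtain ⟨S', hS', hcard, hint, c0, c1, c2⟩ :=
        num_step h01 h02 h12 hA hS hb (Nat.le_of_lt_succ hx) hy' hz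
      refine ⟨b, hb, hba, S', hS', by omega, hint, ?_⟩
      apply ih S' b w' hS' (hS hb) e0 e1 e2
      rw [c0, c1, c2]
      simpa only [e0, e1, e2] using hnum
    rw [Finset.disjoint_left] at h01 h02 h12
    rcases hn with ⟨hc, hn⟩ | ⟨hc, hn⟩ | ⟨hc, hn⟩
    · obtain ⟨b, hb, hbA, hba⟩ := exists_mem_inter_ne hc h0.1
      refine main b hb hba 0 ?_ ?_ ?_ (by simpa using hn)
      · simpa using hbA
      · simpa using h01 hbA
      · simpa using h02 hbA
    · obtain ⟨b, hb, hbA, hba⟩ := exists_mem_inter_ne hc h1.1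
      refine main b hb hba 1 ?_ ?_ ?_ (by simpa using hn)
      · simp at hbA; simp [hbA]
      · simpa using hbA
      · simpa using h12 hbA
    · obtain ⟨b, hb, hbA, hba⟩ := exists_mem_inter_ne hc h2.1
      refine main b hb hba 2 ?_ ?_ ?_ (by simpa using hn)
      · have := fun h => h02 h hbA
        simpa using this
      · have := fun h => h12 h hbA
        simpa using this
      · simpa using hbA

theorem main_five : MainK 5 := by
  suffices H : ∀ n, ∀ (C S T : Finset ℕ) (a τ : ℕ) (ds : List ℕ), C.card = 5 → S ⊆ C → T ⊆ C →
      a ∈ S → τ ∈ T → ds.length = n + 4 → OkD 5 S.card ds → lastD S.card ds = T.card →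
      GoodC C T τ ds S a by
    intro C S T a τ ds hC hS hT ha hτ hlen
    exact H (ds.length - 4) C S T a τ ds hC hS hT ha hτ (by omega)
  intro n
  induction n with
  | zero =>
    intro C S T a τ ds hC hS hT ha hτ hlen hok hlast
    match ds, hlen with
    | [d1, d2, d3, d4], _ =>
      simp only [OkD, lastD] at hok hlast
      obtain ⟨g0, s0, g1, s1, g2, s2, g3, s3, g4⟩ := hok
      have hA0 : (T.erase τ).card = T.card - 1 := Finset.card_erase_of_mem hτ
      have hA2 : (C \ T).card = C.card - T.card := Finset.card_sdiff_of_subset hT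
      have hp : (S ∩ T.erase τ).card ≤ (T.erase τ).card := Finset.card_le_card Finset.inter_subset_right
      have hq : (S ∩ (C \ T)).card ≤ (C \ T).card := Finset.card_le_card Finset.inter_subset_right
      have ht : (S ∩ {τ}).card ≤ ({τ} : Finset ℕ).card := Finset.card_le_card Finset.inter_subset_right
      rw [Finset.card_singleton] at ht
      have hsum : (S ∩ T.erase τ).card + (S ∩ {τ}).card + (S ∩ (C \ T)).card = S.card := by
        rw [← Finset.card_union_of_disjoint, ← Finset.card_union_of_disjoint]
        · congr 1
          ext v
          have := @hS v
          have := @hT v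
          simp only [Finset.mem_union, Finset.mem_inter, Finset.mem_erase, Finset.mem_singleton,
            Finset.mem_sdiff]
          grind
        · rw [Finset.disjoint_left]; intro v; simp; grind
        · rw [Finset.disjoint_left]; intro v; simp; grind
      have pos : ∀ A : Finset ℕ, a ∈ A → 1 ≤ (S ∩ A).card := fun A h =>
        Finset.card_pos.2 ⟨a, by simp [ha, h]⟩
      obtain ⟨w, hw, w0, w1, w2⟩ : ∃ w < 3, (a ∈ T.erase τ ↔ w = 0) ∧
          (a ∈ ({τ} : Finset ℕ) ↔ w = 1) ∧ (a ∈ C \ T ↔ w = 2) := by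
        by_cases h : a = τ
        · exact ⟨1, by simp [h, hτ]⟩
        · by_cases h' : a ∈ T
          · exact ⟨0, by simp [h, h']⟩
          · exact ⟨2, by simp [h, h', hS ha]⟩
      apply num_good hT hτ _ S a w hS (hS ha) w0 w1 w2
      rw [hC, ← hlast]
      apply num_base S.card <;> first | omega | skip
      · exact fun h => pos _ (w0.2 h)
      · exact fun h => pos _ (w1.2 h)
      · exact fun h => pos _ (w2.2 h)
  | succ n ih =>
    intro C S T a τ ds hC hS hT ha hτ hlen hok hlast
    match ds, hlen with
    | d2 :: ds, hlen =>
      obtain ⟨hS2, hsum, hok2⟩ := hok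
      have hd2 := hok2.two_le
      have hCS : (C \ S).card = 5 - S.card := by rw [Finset.card_sdiff_of_subset hS, hC]
      obtain ⟨b, hb, hba⟩ := Finset.exists_mem_ne (show 1 < S.card by omega) a
      obtain ⟨S', hS', hcard, hint, -, -⟩ := step_exists (C := C) (S := S) (R := ∅) (F := ∅)
          (d := d2) hb hS (by simp) (by omega) (by simp; omega) (by simp; omega) (by simp)
      have hbS' : b ∈ S' := by
        have : b ∈ S ∩ S' := by rw [hint]; simp
        exact (Finset.mem_inter.1 this).2
      exact ⟨b, hb, hba, S', hS', hcard, hint, ih C S' T b τ ds hC hS' hT hbS' hτ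
        (by simp at hlen; omega) (by rw [hcard]; exact hok2) (by rw [hcard]; exact hlast)⟩

theorem main_all (k : ℕ) (hk : 5 ≤ k) : MainK k := by
  induction k, hk using Nat.le_induction with
  | base => exact main_five
  | succ k hk ih => exact main_succ k hk ih

theorem good_mono {C C' T : Finset ℕ} {τ : ℕ} (h : C ⊆ C') (ds : List ℕ) : ∀ S a,
    GoodC C T τ ds S a → GoodC C' T τ ds S a := by
  induction ds with
  | nil => exact fun S a hg => hg
  | cons d ds ih =>
    rintro S a ⟨b, hb, hba, S', hS', hcard, hint, hg⟩
    exact ⟨b, hb, hba, S', hS'.trans h, hcard, hint, ih _ _ hg⟩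

theorem good_perm {C T : Finset ℕ} {τ : ℕ} (π : Equiv.Perm ℕ) (ds : List ℕ) : ∀ S a,
    GoodC C T τ ds S a → GoodC (C.image π) (T.image π) (π τ) ds (S.image π) (π a) := by
  induction ds with
  | nil =>
    rintro S a ⟨rfl, hne⟩
    exact ⟨rfl, fun h => hne (π.injective h)⟩
  | cons d ds ih =>
    rintro S a ⟨b, hb, hba, S', hS', hcard, hint, hg⟩
    refine ⟨π b, Finset.mem_image_of_mem _ hb, fun h => hba (π.injective h), S'.image π,
      Finset.image_subset_image hS', ?_, ?_, ih _ _ hg⟩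
    · rw [Finset.card_image_of_injective _ π.injective, hcard]
    · rw [← Finset.image_inter _ _ π.injective, hint, Finset.image_singleton]

/-- Switch from color `x` to the unused color `y` from the next vertex on. -/
theorem good_swap_step {C T : Finset ℕ} {τ x y : ℕ} (hx : x ∈ C) (hy : y ∈ C)
    {d : ℕ} {ds : List ℕ} {S : Finset ℕ} {a b : ℕ} (hyS : y ∉ S) (hb : b ∈ S) (hba : b ≠ a)
    (hbx : b ≠ x) {S' : Finset ℕ} (hS' : S' ⊆ C.erase y) (hcard : S'.card = d)
    (hint : S ∩ S' = {b})
    (hg : GoodC (C.erase y) (T.image (Equiv.swap x y)) (Equiv.swap x y τ) ds S' b) :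
    GoodC C T τ (d :: ds) S a := by
  have hby : b ≠ y := fun h => hyS (h ▸ hb)
  have h1 := good_perm (Equiv.swap x y) ds S' b (good_mono (Finset.erase_subset y C) ds _ _ hg)
  have hC : C.image (Equiv.swap x y) ⊆ C := by
    intro v hv
    obtain ⟨u, hu, rfl⟩ := Finset.mem_image.1 hv
    rw [Equiv.swap_apply_def]; split_ifs <;> assumption
  have h2 := good_mono hC ds _ _ h1
  rw [Finset.image_image, Equiv.swap_apply_self, Equiv.swap_apply_of_ne_of_ne hbx hby] at h2
  have hid : (Equiv.swap x y : ℕ → ℕ) ∘ (Equiv.swap x y : ℕ → ℕ) = id := by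
    ext v; simp
  rw [hid, Finset.image_id] at h2
  refine ⟨b, hb, hba, _, (Finset.image_subset_image (hS'.trans (Finset.erase_subset y C))).trans hC,
    ?_, ?_, h2⟩
  · rw [Finset.card_image_of_injective _ (Equiv.injective _), hcard]
  · have hyS' : y ∉ S' := fun h => by simpa using hS' h
    ext v
    have e := fun v => Finset.ext_iff.1 hint v
    simp only [Finset.mem_inter, Finset.mem_singleton, Finset.mem_image] at e ⊢
    constructor
    · rintro ⟨hv, u, hu, rfl⟩
      rw [Equiv.swap_apply_def] at hv ⊢
      split_ifs at hv ⊢ with h1 h2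
      · exact absurd hv hyS
      · exact absurd (h2 ▸ hu) hyS'
      · exact (e u).1 ⟨hv, hu⟩
    · rintro rfl
      exact ⟨hb, v, ((e v).2 rfl).2, Equiv.swap_apply_of_ne_of_ne hbx hby⟩

theorem main_big (k : ℕ) (hk : 5 ≤ k) (m : ℕ) : ∀ (C S T : Finset ℕ) (a τ : ℕ) (ds : List ℕ),
    C.card = k + m → S ⊆ C → T ⊆ C → a ∈ S → τ ∈ T →
    k ≤ ds.length + 1 → OkD k S.card ds → lastD S.card ds = T.card → GoodC C T τ ds S a := by
  induction m with
  | zero => exact main_all k hk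
  | succ m ih =>
    intro C S T a τ ds hC hS hT ha hτ hlen hok hlast
    match ds, hlen with
    | [], hlen => simp at hlen; omega
    | [d1], hlen => simp at hlen; omega
    | d1 :: d2 :: ds, hlen =>
    have hTle := hok.last_le
    have hsum := hok.2.1
    rw [hlast] at hTle
    by_cases hU : ∃ y ∈ C, y ∉ S ∧ y ∉ T
    · obtain ⟨y, hy, hyS, hyT⟩ := hU
      exact good_mono (Finset.erase_subset y C) _ _ _ (ih (C.erase y) S T a τ _
        (by rw [Finset.card_erase_of_mem hy, hC]; omega)
        (Finset.subset_erase.2 ⟨hS, hyS⟩) (Finset.subset_erase.2 ⟨hT, hyT⟩) ha hτ hlen hok hlast)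
    · push Not at hU
      obtain ⟨x, hx, hxT⟩ := Finset.exists_mem_notMem_of_card_lt_card (show T.card < C.card by omega)
      obtain ⟨y, hy, hyS⟩ := Finset.exists_mem_notMem_of_card_lt_card (show S.card < C.card by omega)
      have hyT := hU y hy hyS
      have hxS : x ∈ S := by by_contra h; exact hxT (hU x hx h)
      have hxy : x ≠ y := fun h => hxT (h ▸ hyT)
      have hg := ih (C.erase y) S (T.image (Equiv.swap x y)) a (Equiv.swap x y τ) (d1 :: d2 :: ds)
        (by rw [Finset.card_erase_of_mem hy, hC]; omega) (Finset.subset_erase.2 ⟨hS, hyS⟩)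
        (by
          intro v hv
          obtain ⟨u, hu, rfl⟩ := Finset.mem_image.1 hv
          rw [Equiv.swap_apply_def]
          split_ifs with h1 h2
          · exact absurd (h1 ▸ hu) hxT
          · simp [hxy, hx]
          · simp [h2, hT hu]) ha (Finset.mem_image_of_mem _ hτ) hlen hok
        (by rw [hlast, Finset.card_image_of_injective _ (Equiv.injective _)])
      obtain ⟨b, hb, hba, S', hS', hcard, hint, hg⟩ := hg
      by_cases hbx : b = x
      · obtain ⟨b', hb', hba', S'', hS'', hcard', hint', hg⟩ := hg
        exact ⟨b, hb, hba, S', hS'.trans (Finset.erase_subset _ _), hcard, hint,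
          good_swap_step hx hy (fun h => by simpa using hS' h) hb' hba' (hbx ▸ hba') hS'' hcard' hint' hg⟩
      · exact good_swap_step hx hy hyS hb hba hbx hS' hcard hint hg

theorem good_seq {C T : Finset ℕ} {τ : ℕ} (ds : List ℕ) : ∀ (S : Finset ℕ) (a : ℕ), S ⊆ C → GoodC C T τ ds S a →
    ∃ (Sq : ℕ → Finset ℕ) (al : ℕ → ℕ), Sq 0 = S ∧ al 0 = a ∧ Sq ds.length = T ∧
      al (ds.length + 1) = τ ∧ (∀ i ≤ ds.length, Sq i ⊆ C ∧ (Sq i).card = (S.card :: ds).getD i 0) ∧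
      (∀ i < ds.length, Sq i ∩ Sq (i + 1) = {al (i + 1)}) ∧ ∀ i ≤ ds.length, al i ≠ al (i + 1) := by
  induction ds with
  | nil =>
    rintro S a hS ⟨rfl, hne⟩
    refine ⟨fun _ => S, fun i => if i = 0 then a else τ, rfl, rfl, rfl, rfl, ?_, ?_, ?_⟩
    · intro i hi
      simp at hi; subst hi; simp [hS]
    · intro i hi; simp at hi
    · intro i hi; simp at hi; subst hi; simpa using hne
  | cons d ds ih =>
    rintro S a hS ⟨b, hb, hba, S', hS', hcard, hint, hg⟩
    obtain ⟨Sq, al, h1, h2, h3, h4, h5, h6, h7⟩ := ih S' b hS' hg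
    refine ⟨fun i => Nat.casesOn i S Sq, fun i => Nat.casesOn i a al, rfl, rfl, h3, h4, ?_, ?_, ?_⟩
    · intro i hi
      cases i with
      | zero => simp [hS]
      | succ i =>
        have := h5 i (by simpa using hi)
        rw [hcard] at this
        simpa using this
    · intro i hi
      cases i with
      | zero => simpa [h1, h2] using hint
      | succ i => exact h6 i (by simpa using hi)
    · intro i hi
      cases i with
      | zero => simpa [h2] using hba.symm
      | succ i => exact h7 i (by simpa using hi)

theorem cat_adj_spine {ℓ : ℕ} {d : ℕ → ℕ} (i j : Fin (ℓ + 2)) :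
    (Cat ℓ d).Adj (Sum.inl i) (Sum.inl j) ↔ (j : ℕ) = i + 1 ∨ (i : ℕ) = j + 1 := by
  simp only [Cat, SimpleGraph.fromRel_adj, CatRel, ne_eq, Sum.inl.injEq]
  constructor
  · exact fun h => h.2
  · intro h
    refine ⟨?_, h⟩
    rintro rfl
    omega

theorem cat_adj_leaf {ℓ : ℕ} {d : ℕ → ℕ} (p : Σ i : Fin ℓ, Fin (d (i.val + 1) - 2)) (j : Fin (ℓ + 2)) :
    (Cat ℓ d).Adj (Sum.inr p) (Sum.inl j) ↔ (j : ℕ) = p.1 + 1 := by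
  simp [Cat, SimpleGraph.fromRel_adj, CatRel]

theorem cat_adj_leaf_symm {ℓ : ℕ} {d : ℕ → ℕ} (p : Σ i : Fin ℓ, Fin (d (i.val + 1) - 2)) (j : Fin (ℓ + 2)) :
    (Cat ℓ d).Adj (Sum.inl j) (Sum.inr p) ↔ (j : ℕ) = p.1 + 1 := by
  rw [SimpleGraph.adj_comm, cat_adj_leaf]

theorem cat_adj_leaves {ℓ : ℕ} {d : ℕ → ℕ} (p q : Σ i : Fin ℓ, Fin (d (i.val + 1) - 2)) :
    ¬ (Cat ℓ d).Adj (Sum.inr p) (Sum.inr q) := by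
  simp [Cat, SimpleGraph.fromRel_adj, CatRel]

theorem ndeg_ge {ℓ : ℕ} {d : ℕ → ℕ} (i : Fin ℓ) (hd : 2 ≤ d (i + 1)) :
    d (i + 1) ≤ ndeg (Cat ℓ d) (Sum.inl ⟨i + 1, by omega⟩) := by
  let g : Bool ⊕ Fin (d (i.val + 1) - 2) → CatV ℓ d
    | Sum.inl false => Sum.inl ⟨i, by omega⟩
    | Sum.inl true => Sum.inl ⟨i + 2, by omega⟩
    | Sum.inr p => Sum.inr ⟨i, p⟩
  have hg : Function.Injective g := by
    rintro ((_ | _) | p) ((_ | _) | q) h <;> simp [g] at h ⊢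
    exact h
  have hr : Set.range g ⊆ (Cat ℓ d).neighborSet (Sum.inl ⟨i + 1, by omega⟩) := by
    rintro _ ⟨(_ | _) | p, rfl⟩ <;>
      simp [g, SimpleGraph.mem_neighborSet, cat_adj_spine, cat_adj_leaf_symm]
  have := Set.ncard_le_ncard hr (Set.toFinite _)
  rw [← Set.image_univ, Set.ncard_image_of_injective _ hg, Set.ncard_univ, Nat.card_eq_fintype_card] at this
  simp at this
  unfold ndeg
  omega

theorem sigma_ge {ℓ : ℕ} {d : ℕ → ℕ} (hd : ∀ i, 1 ≤ i → i ≤ ℓ → 2 ≤ d i) (i : ℕ) (h1 : 1 ≤ i)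
    (h2 : i + 1 ≤ ℓ) : d i + d (i + 1) ≤ sigmaG (Cat ℓ d) + 1 := by
  obtain ⟨i, rfl⟩ : ∃ j, i = j + 1 := ⟨i - 1, by omega⟩
  have a1 := ndeg_ge (d := d) (⟨i, by omega⟩ : Fin ℓ) (hd _ (by simp) (by simp; omega))
  have a2 := ndeg_ge (d := d) (⟨i + 1, by omega⟩ : Fin ℓ) (hd _ (by simp) (by simp; omega))
  have hb : BddAbove {m | ∃ x y, (Cat ℓ d).Adj x y ∧ m = ndeg (Cat ℓ d) x + ndeg (Cat ℓ d) y - 1} := by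
    apply Set.Finite.bddAbove
    apply (Set.finite_range (fun p : CatV ℓ d × CatV ℓ d =>
      ndeg (Cat ℓ d) p.1 + ndeg (Cat ℓ d) p.2 - 1)).subset
    rintro m ⟨x, y, -, rfl⟩
    exact ⟨(x, y), rfl⟩
  have := le_csSup hb ⟨Sum.inl ⟨i + 1, by omega⟩, Sum.inl ⟨i + 1 + 1, by omega⟩,
    (cat_adj_spine _ _).2 (Or.inl rfl), rfl⟩
  unfold sigmaG
  simp only at a1 a2
  omega

/-- The three kinds of edges at an inner spine vertex. -/
theorem einc_iff {ℓ : ℕ} {d : ℕ → ℕ} (i : Fin ℓ) (e : Sym2 (CatV ℓ d)) :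
    e ∈ Einc (Cat ℓ d) (Sum.inl ⟨i + 1, by omega⟩) ↔
      e = s(Sum.inl ⟨i, by omega⟩, Sum.inl ⟨i + 1, by omega⟩) ∨
      e = s(Sum.inl ⟨i + 1, by omega⟩, Sum.inl ⟨i + 2, by omega⟩) ∨
      ∃ p, e = s(Sum.inr ⟨i, p⟩, Sum.inl ⟨i + 1, by omega⟩) := by
  constructor
  · rintro ⟨he, hm⟩
    obtain ⟨v, rfl⟩ := hm
    rw [SimpleGraph.mem_edgeSet] at he
    rcases v with j | ⟨j, p⟩
    · rw [cat_adj_spine] at he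
      simp only at he
      rcases he with he | he
      · right; left
        have : j = ⟨i + 2, by omega⟩ := Fin.ext he
        rw [this]
      · left
        have : j = ⟨i, by omega⟩ := Fin.ext (by simp only; omega)
        rw [this, Sym2.eq_swap]
    · rw [cat_adj_leaf_symm] at he
      simp only at he
      obtain rfl : i = j := Fin.ext (by omega)
      right; right
      exact ⟨p, Sym2.eq_swap⟩
  · rintro (rfl | rfl | ⟨p, rfl⟩) <;>
      simp [Einc, cat_adj_spine, cat_adj_leaf]

/-- The inner spine vertex at which all edges through `v` are located (index shifted by one). -/
def hubV (ℓ : ℕ) (d : ℕ → ℕ) : CatV ℓ d → ℕ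
  | Sum.inl i => if (i : ℕ) = 0 then 0 else if (i : ℕ) = ℓ + 1 then ℓ - 1 else i - 1
  | Sum.inr p => p.1

theorem hub_lt {ℓ : ℕ} {d : ℕ → ℕ} (hl : 1 ≤ ℓ) (v : CatV ℓ d) : hubV ℓ d v < ℓ := by
  rcases v with i | p
  · have := i.2
    simp only [hubV]; split_ifs <;> omega
  · exact p.1.2

theorem hub_mem {ℓ : ℕ} {d : ℕ → ℕ} (hl : 1 ≤ ℓ) (v : CatV ℓ d) (e : Sym2 (CatV ℓ d))
    (he : e ∈ (Cat ℓ d).edgeSet) (hv : v ∈ e) :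
    e ∈ Einc (Cat ℓ d) (Sum.inl ⟨hubV ℓ d v + 1, by have := hub_lt hl v; omega⟩) := by
  refine ⟨he, ?_⟩
  obtain ⟨u, rfl⟩ := hv
  rw [SimpleGraph.mem_edgeSet] at he
  rw [Sym2.mem_iff]
  rcases v with i | p <;> rcases u with j | q
  · rw [cat_adj_spine] at he
    have := i.2
    have := j.2
    simp only [hubV, Sum.inl.injEq, Fin.ext_iff]
    split_ifs <;> omega
  · rw [cat_adj_leaf_symm] at he
    have := q.1.2
    simp only [hubV, Sum.inl.injEq, Fin.ext_iff]
    left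
    split_ifs <;> omega
  · rw [cat_adj_leaf] at he
    simp only [hubV, Sum.inl.injEq, Fin.ext_iff]
    right; omega
  · exact absurd he (cat_adj_leaves _ _)

theorem hub_adj {ℓ : ℕ} {d : ℕ → ℕ} (u v : CatV ℓ d) (h : (Cat ℓ d).Adj u v) :
    hubV ℓ d u = hubV ℓ d v ∨ hubV ℓ d v = hubV ℓ d u + 1 ∨ hubV ℓ d u = hubV ℓ d v + 1 := by
  rcases u with i | p <;> rcases v with j | q
  · rw [cat_adj_spine] at h
    have := i.2
    have := j.2
    simp only [hubV]
    split_ifs <;> omega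
  · rw [cat_adj_leaf_symm] at h
    have := q.1.2
    simp only [hubV]
    split_ifs <;> omega
  · rw [cat_adj_leaf] at h
    have := p.1.2
    simp only [hubV]
    split_ifs <;> omega
  · exact absurd h (cat_adj_leaves _ _)

/-- The edge coloring determined by spine colors and leaf colors. -/
def colV (ℓ : ℕ) (d : ℕ → ℕ) (al : ℕ → ℕ) (g : (i : Fin ℓ) → Fin (d (i.val + 1) - 2) → ℕ) :
    CatV ℓ d → CatV ℓ d → ℕ
  | Sum.inl i, Sum.inl j => al (min (i : ℕ) j)
  | Sum.inr p, Sum.inl _ => g p.1 p.2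
  | Sum.inl _, Sum.inr p => g p.1 p.2
  | Sum.inr _, Sum.inr _ => 0

theorem colV_symm (ℓ : ℕ) (d : ℕ → ℕ) (al : ℕ → ℕ) (g : (i : Fin ℓ) → Fin (d (i.val + 1) - 2) → ℕ)
    (u v : CatV ℓ d) : colV ℓ d al g u v = colV ℓ d al g v u := by
  rcases u with i | p <;> rcases v with j | q <;> simp [colV, min_comm]

/-- The edge coloring on unordered pairs. -/
def colE (ℓ : ℕ) (d : ℕ → ℕ) (al : ℕ → ℕ) (g : (i : Fin ℓ) → Fin (d (i.val + 1) - 2) → ℕ) :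
    Sym2 (CatV ℓ d) → ℕ :=
  Sym2.lift ⟨colV ℓ d al g, colV_symm ℓ d al g⟩

theorem build {ℓ : ℕ} {d : ℕ → ℕ} (hl : 1 ≤ ℓ) (C : Finset ℕ) (Sq : ℕ → Finset ℕ) (al : ℕ → ℕ)
    (hSC : ∀ i < ℓ, Sq i ⊆ C) (hcard : ∀ i < ℓ, (Sq i).card = d (i + 1))
    (hint : ∀ i, i + 1 < ℓ → Sq i ∩ Sq (i + 1) = {al (i + 1)})
    (hne : ∀ i < ℓ, al i ≠ al (i + 1)) (hm0 : ∀ i < ℓ, al i ∈ Sq i) (hm1 : ∀ i < ℓ, al (i + 1) ∈ Sq i) :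
    CatPrecolorExists ℓ d C (Sq 0) (Sq (ℓ - 1)) (al 0) (al ℓ) := by
  have hg : ∀ i : Fin ℓ, ∃ g : Fin (d (i.val + 1) - 2) → ℕ, Function.Injective g ∧
      ∀ c, (∃ p, g p = c) ↔ c ∈ Sq i ∧ c ≠ al i ∧ c ≠ al (i + 1) := by
    intro i
    have h1 : (((Sq i).erase (al i)).erase (al (i + 1))).card = d (i + 1) - 2 := by
      rw [Finset.card_erase_of_mem, Finset.card_erase_of_mem (hm0 i i.2), hcard i i.2]
      · rfl
      · simp [(hne i i.2).symm, hm1 i i.2]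
    refine ⟨Finset.orderEmbOfFin _ h1, (Finset.orderEmbOfFin _ h1).injective, fun c => ?_⟩
    have := Set.ext_iff.1 (Finset.range_orderEmbOfFin _ h1) c
    rw [Set.mem_range] at this
    rw [this]
    simp
    tauto
  choose g hginj hgr using hg
  set φ := colE ℓ d al g with hφ
  have c0 : ∀ i : Fin ℓ, φ s(Sum.inl ⟨i, by omega⟩, Sum.inl ⟨i + 1, by omega⟩) = al i := by
    intro i; simp [hφ, colE, colV]
  have c1 : ∀ i : Fin ℓ, φ s(Sum.inl ⟨i + 1, by omega⟩, Sum.inl ⟨i + 2, by omega⟩) = al (i + 1) := by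
    intro i; simp [hφ, colE, colV]
  have c2 : ∀ (i : Fin ℓ) p, φ s(Sum.inr ⟨i, p⟩, Sum.inl ⟨i + 1, by omega⟩) = g i p := by
    intro i p; simp [hφ, colE, colV]
  have himg : ∀ i : Fin ℓ, φ '' Einc (Cat ℓ d) (Sum.inl ⟨i + 1, by omega⟩) = ↑(Sq i) := by
    intro i
    ext c
    simp only [Set.mem_image, einc_iff, Finset.mem_coe]
    constructor
    · rintro ⟨e, rfl | rfl | ⟨p, rfl⟩, rfl⟩
      · rw [c0]; exact hm0 i i.2
      · rw [c1]; exact hm1 i i.2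
      · rw [c2]; exact ((hgr i _).1 ⟨p, rfl⟩).1
    · intro hc
      by_cases e0 : c = al i
      · exact ⟨_, Or.inl rfl, by rw [c0, e0]⟩
      · by_cases e1 : c = al (i + 1)
        · exact ⟨_, Or.inr (Or.inl rfl), by rw [c1, e1]⟩
        · obtain ⟨p, hp⟩ := (hgr i c).2 ⟨hc, e0, e1⟩
          exact ⟨_, Or.inr (Or.inr ⟨p, rfl⟩), by rw [c2, hp]⟩
  have hinj : ∀ i : Fin ℓ, ∀ e ∈ Einc (Cat ℓ d) (Sum.inl ⟨i + 1, by omega⟩),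
      ∀ f ∈ Einc (Cat ℓ d) (Sum.inl ⟨i + 1, by omega⟩), φ e = φ f → e = f := by
    intro i e he f hf h
    have hn := hne i i.2
    have hgp := fun p => (hgr i _).1 ⟨p, rfl⟩
    rw [einc_iff] at he hf
    rcases he with rfl | rfl | ⟨p, rfl⟩ <;> rcases hf with rfl | rfl | ⟨q, rfl⟩ <;>
      simp only [c0, c1, c2] at h
    · rfl
    · exact absurd h hn
    · exact absurd h.symm (hgp q).2.1
    · exact absurd h.symm hn
    · rfl
    · exact absurd h.symm (hgp q).2.2
    · exact absurd h (hgp p).2.1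
    · exact absurd h (hgp p).2.2
    · rw [hginj i h]
  have hmem : ∀ i : Fin ℓ, ∀ e ∈ Einc (Cat ℓ d) (Sum.inl ⟨i + 1, by omega⟩), φ e ∈ Sq i := by
    intro i e he
    have : φ e ∈ (↑(Sq i) : Set ℕ) := by rw [← himg]; exact ⟨e, he, rfl⟩
    simpa using this
  have hcons : ∀ i (hi : i + 1 < ℓ), ∀ e ∈ Einc (Cat ℓ d) (Sum.inl ⟨i + 1, by omega⟩),
      ∀ f ∈ Einc (Cat ℓ d) (Sum.inl ⟨i + 1 + 1, by omega⟩), φ e = φ f → e = f := by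
    intro i hi e he f hf h
    have m1 := hmem ⟨i, by omega⟩ e he
    have m2 := hmem ⟨i + 1, by omega⟩ f hf
    have hm : φ e ∈ Sq i ∩ Sq (i + 1) := Finset.mem_inter.2 ⟨m1, h ▸ m2⟩
    rw [hint i hi, Finset.mem_singleton] at hm
    have k1 := hinj ⟨i, by omega⟩ e he _ ((einc_iff _ _).2 (Or.inr (Or.inl rfl)))
      (by rw [hm, c1])
    have k2 := hinj ⟨i + 1, by omega⟩ f hf _ ((einc_iff _ _).2 (Or.inl rfl))
      (by rw [← h, hm, c0])
    rw [k1, k2]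
  refine ⟨φ, ?_, ?_, ?_, ?_, ?_, ?_⟩
  · intro e he
    induction e using Sym2.ind with
    | _ u v =>
    have := hub_mem hl u _ he (by simp)
    exact hSC _ (hub_lt hl u) (hmem ⟨_, hub_lt hl u⟩ _ this)
  · rintro e he f hf hef ⟨u, v, hu, hv, huv⟩ hc
    apply hef
    have hub : ∀ (w : CatV ℓ d) (e : Sym2 (CatV ℓ d)), e ∈ (Cat ℓ d).edgeSet → w ∈ e →
        ∃ m, ∃ h : m < ℓ, hubV ℓ d w = m ∧ e ∈ Einc (Cat ℓ d) (Sum.inl ⟨m + 1, by omega⟩) :=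
      fun w e he hw => ⟨_, hub_lt hl w, rfl, hub_mem hl w e he hw⟩
    obtain ⟨m, hlu, hmu, he'⟩ := hub u e he hu
    obtain ⟨n, hlv, hnv, hf'⟩ := hub v f hf hv
    have hh : hubV ℓ d u = hubV ℓ d v ∨ hubV ℓ d v = hubV ℓ d u + 1 ∨ hubV ℓ d u = hubV ℓ d v + 1 := by
      rcases huv with rfl | h
      · exact Or.inl rfl
      · exact hub_adj u v h
    rw [hmu, hnv] at hh
    rcases hh with rfl | rfl | rfl
    · exact hinj ⟨m, hlu⟩ e he' f hf' hc
    · exact hcons m hlv e he' f hf' hc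
    · exact (hcons n hlu f hf' e he' hc.symm).symm
  · exact himg ⟨0, by omega⟩
  · have := himg ⟨ℓ - 1, by omega⟩
    simp only [Nat.sub_add_cancel hl] at this
    exact this
  · exact c0 ⟨0, by omega⟩
  · simp [hφ, colE, colV]

theorem okD_range {k : ℕ} {d : ℕ → ℕ} (n : ℕ) : ∀ j, (∀ i, j ≤ i → i ≤ j + n → 2 ≤ d i) →
    (∀ i, j ≤ i → i < j + n → d i + d (i + 1) ≤ k) →
    OkD k (d j) ((List.range' (j + 1) n).map d) ∧
      lastD (d j) ((List.range' (j + 1) n).map d) = d (j + n) := by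
  induction n with
  | zero => intro j h _; exact ⟨h j le_rfl le_rfl, rfl⟩
  | succ n ih =>
    intro j h1 h2
    obtain ⟨i1, i2⟩ := ih (j + 1) (fun i a b => h1 i (by omega) (by omega))
      (fun i a b => h2 i (by omega) (by omega))
    rw [List.range'_succ, List.map_cons]
    refine ⟨⟨h1 j le_rfl (by omega), h2 j le_rfl (by omega), i1⟩, ?_⟩
    rw [show j + (n + 1) = j + 1 + n by omega]
    exact i2

theorem twoSided_succ_sigma (ℓ : ℕ) (d : ℕ → ℕ)
    (hd : ∀ i, 1 ≤ i → i ≤ ℓ → 2 ≤ d i)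
    (h4 : 4 ≤ sigmaG (Cat ℓ d))
    (hl : ellSigma (sigmaG (Cat ℓ d) + 1) ≤ ℓ)
    (κ : ℕ) (hκ : sigmaG (Cat ℓ d) + 1 ≤ κ) :
    TwoSidedPrecolorable ℓ d κ := by
  have hs := sigma_ge hd
  generalize sigmaG (Cat ℓ d) = σ at *
  have hl' : σ + 1 ≤ ℓ := by
    unfold ellSigma at hl
    split_ifs at hl <;> omega
  intro C C₁ Cl hC hC₁ hCl hc1 hcl α₀ hα₀ αl hαl
  obtain ⟨hok, hlast⟩ := okD_range (k := σ + 1) (d := d) (ℓ - 1) 1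
    (fun i a b => hd i a (by omega)) (fun i a b => hs i a (by omega))
  have hlen : ((List.range' (1 + 1) (ℓ - 1)).map d).length = ℓ - 1 := by simp
  have hgood := main_big (σ + 1) (by omega) (κ - (σ + 1)) C C₁ Cl α₀ αl
    ((List.range' (1 + 1) (ℓ - 1)).map d) (by omega) hC₁ hCl hα₀ hαl
    (by omega) (by rw [hc1]; exact hok)
    (by rw [hc1, hlast, hcl]; congr 1; omega)
  obtain ⟨Sq, al, e0, e1, e2, e3, e4, e5, e6⟩ := good_seq _ _ _ hC₁ hgood
  rw [hlen] at e2 e3 e4 e5 e6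
  rw [Nat.sub_add_cancel (by omega)] at e3
  have mem1 : ∀ i, i + 1 < ℓ → al (i + 1) ∈ Sq i ∧ al (i + 1) ∈ Sq (i + 1) := by
    intro i hi
    rw [← Finset.mem_inter, e5 i (by omega)]
    simp
  have := build (ℓ := ℓ) (d := d) (by omega) C Sq al (fun i hi => (e4 i (by omega)).1) ?_
    (fun i hi => e5 i (by omega)) (fun i hi => e6 i (by omega)) ?_ ?_
  · rwa [e0, e1, e2, e3] at this
  · intro i hi
    rw [(e4 i (by omega)).2]
    cases i with
    | zero => simpa using hc1
    | succ i =>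
      have : i < ℓ - 1 := by omega
      simp [List.getD_eq_getElem?_getD, this]
      congr 1; omega
  · intro i hi
    cases i with
    | zero => rw [e0, e1]; exact hα₀
    | succ i => exact (mem1 i hi).2
  · intro i hi
    by_cases h : i + 1 < ℓ
    · exact (mem1 i h).1
    · obtain rfl : i = ℓ - 1 := by omega
      rw [e2, Nat.sub_add_cancel (by omega), e3]; exact hαl
end
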